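/- arXiv:1902.03441 — 4 statements merged into one kernel-verified Lean document; each statement's English description precedes it below -/
import Mathlib

section
/- Let g : X → (0,1) be continuous with Σ_{a∈A} g(ax) = 1 for all x ∈ X, set φ = log g, and let μ be a probability measure on X with ∫ L_φ f dμ = ∫ f dμ for all continuous f (an equilibrium state of φ). Then for every q ∈ ℝ the limit M_μ(q) = lim_n (1/n) log Σ_{a_1^n ∈ A^n} μ(a_1^n)^{1−q} exists and equals P((1−q)φ), the topological pressure of (1−q)φ. -/
open MeasureTheory Filter Topology Set

namespace RTSpec

variable (A : Type*) [Fintype A] [TopologicalSpace A] [DiscreteTopology A]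
  [MeasurableSpace A] [BorelSpace A]

/-- The sequence space `X = A^ℕ` (0-indexed: `x 0` is the paper's `x₁`). -/
abbrev X := ℕ → A

/-- The shift map `θ`. -/
def shift : X A → X A := fun x n => x (n + 1)

/-- The cylinder `[a_1^n]` based on the word `w = a_1^n`. -/
def cyl {n : ℕ} (w : Fin n → A) : Set (X A) := {x | ∀ i : Fin n, x i.val = w i}

/-- Return time `R_n(x) = inf {k ≥ 2 : x_k^{k+n-1} = x_1^n}` (with `sInf ∅ = 0`). -/
noncomputable def retTime (n : ℕ) (x : X A) : ℕ := sInf {k | 2 ≤ k ∧ ∀ i < n, x (k - 1 + i) = x i}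

/-- Hitting time `T_{a_1^n}(y) = inf {k ≥ 1 : y_k^{k+n-1} = a_1^n}`. -/
noncomputable def hitTime {n : ℕ} (w : Fin n → A) (y : X A) : ℕ :=
  sInf {k | 1 ≤ k ∧ ∀ i : Fin n, y (k - 1 + i.val) = w i}

/-- Hitting/return time in the shifted sense: `inf {k ≥ 1 : θ^k y ∈ [a_1^n]}`. -/
noncomputable def hitTime' {n : ℕ} (w : Fin n → A) (y : X A) : ℕ :=
  sInf {k | 1 ≤ k ∧ ∀ i : Fin n, y (k + i.val) = w i}

/-- `τ(a_1^n) = inf {k ≥ 1 : [a_1^n] ∩ θ^{-k}[a_1^n] ≠ ∅}`, the smallest return time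
of the cylinder `[a_1^n]`. -/
noncomputable def tau {n : ℕ} (w : Fin n → A) : ℕ :=
  sInf {k | 1 ≤ k ∧ (cyl A w ∩ {y | ∀ i : Fin n, y (k + i.val) = w i}).Nonempty}

/-- `ζ_μ(a_1^n) = μ([a_1^n] ∩ {T_{a_1^n} ≠ τ(a_1^n)}) / μ([a_1^n])`. -/
noncomputable def zeta (μ : Measure (X A)) {n : ℕ} (w : Fin n → A) : ℝ :=
  (μ (cyl A w ∩ {y | hitTime' A w y ≠ tau A w})).toReal / (μ (cyl A w)).toReal

/-- A shift-invariant Borel probability measure. -/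
def InvProb (η : Measure (X A)) : Prop :=
  IsProbabilityMeasure η ∧ Measure.map (shift A) η = η

/-- The `n`-th term `-(1/n) Σ_{a_1^n} μ(a_1^n) log μ(a_1^n)` of the entropy sequence. -/
noncomputable def entSeq (μ : Measure (X A)) (n : ℕ) : ℝ :=
  -(1 / (n : ℝ)) * ∑ w : Fin n → A, (μ (cyl A w)).toReal * Real.log (μ (cyl A w)).toReal

/-- The entropy `h(μ)`, i.e. the limit of `entSeq` (which always exists for a
shift-invariant measure; we realize it as a liminf). -/
noncomputable def entropy (μ : Measure (X A)) : ℝ := atTop.liminf (entSeq A μ)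

/-- Topological pressure `P(ψ) = sup_η {h(η) + ∫ ψ dη}`, the supremum running over
all shift-invariant probability measures. -/
noncomputable def pressure (ψ : X A → ℝ) : ℝ :=
  sSup {r | ∃ η : Measure (X A), InvProb A η ∧ r = entropy A η + ∫ x, ψ x ∂η}

/-- `sup_η ∫ φ dη` over shift-invariant probability measures. -/
noncomputable def supInt (φ : X A → ℝ) : ℝ :=
  sSup {r | ∃ η : Measure (X A), InvProb A η ∧ r = ∫ x, φ x ∂η}

/-- `inf_η ∫ φ dη` over shift-invariant probability measures. -/
noncomputable def infInt (φ : X A → ℝ) : ℝ :=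
  sInf {r | ∃ η : Measure (X A), InvProb A η ∧ r = ∫ x, φ x ∂η}

/-- `var_n(φ) = sup {|φ(x) - φ(y)| : x_1^n = y_1^n}`. -/
noncomputable def Var (φ : X A → ℝ) (n : ℕ) : ℝ :=
  sSup {r | ∃ x y : X A, (∀ i < n, x i = y i) ∧ r = |φ x - φ y|}

/-- Prepending a symbol: `ax = (a, x_1, x_2, …)`. -/
def prepend (a : A) (x : X A) : X A := fun n => Nat.casesOn n a x

/-- A potential `φ` is normalized if `Σ_{a ∈ A} e^{φ(ax)} = 1` for all `x`. -/
def Normalized (φ : X A → ℝ) : Prop :=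
  ∀ x : X A, ∑ a : A, Real.exp (φ (prepend A a x)) = 1

/-- `μ` is an equilibrium state for `φ`: a probability measure fixed by the dual
transfer operator, i.e. `∫ L_φ f dμ = ∫ f dμ` for every continuous `f`. -/
def IsEqSt (φ : X A → ℝ) (μ : Measure (X A)) : Prop :=
  IsProbabilityMeasure μ ∧ ∀ f : X A → ℝ, Continuous f →
    ∫ x, (∑ a : A, Real.exp (φ (prepend A a x)) * f (prepend A a x)) ∂μ = ∫ x, f x ∂μ

/-- The `n`-th term `(1/n) log ∫ R_n^q dμ` of the return-time `L^q`-spectrum,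
with values in `EReal` (the integral may be infinite). -/
noncomputable def RSeq (μ : Measure (X A)) (q : ℝ) (n : ℕ) : EReal :=
  (((n : ℝ)⁻¹ : ℝ) : EReal) *
    ENNReal.log (∫⁻ x, ENNReal.ofReal ((retTime A n x : ℝ) ^ q) ∂μ)

/-- The `n`-th term `(1/n) log Σ_{a_1^n} μ(a_1^n)^{1-q}` of the `L^q`-spectrum of `μ`. -/
noncomputable def MSeq (μ : Measure (X A)) (q : ℝ) (n : ℕ) : ℝ :=
  (1 / (n : ℝ)) * Real.log (∑ w : Fin n → A, (μ (cyl A w)).toReal ^ (1 - q))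

/-- `Λ^{(n)}(μ) = (1/n) log Σ_{a_1^n} (1 - ζ_μ(a_1^n)) μ(a_1^n)`. -/
noncomputable def LamSeq (μ : Measure (X A)) (n : ℕ) : ℝ :=
  (1 / (n : ℝ)) * Real.log (∑ w : Fin n → A, (1 - zeta A μ w) * (μ (cyl A w)).toReal)

/-- `(1/n) log max_{a_1^n} μ(a_1^n)`. -/
noncomputable def gammaSeq (μ : Measure (X A)) (n : ℕ) : ℝ :=
  (1 / (n : ℝ)) * Real.log (⨆ w : Fin n → A, (μ (cyl A w)).toReal)

/-- `μ` is φ-mixing with rate `ϕ`: `ϕ` decreases to `0` and for all `n, ℓ ≥ 1`,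
all `S` in the σ-algebra generated by coordinates `1, …, n` with `μ S ≠ 0`, and
all `T` in the σ-algebra generated by coordinates `n+ℓ, n+ℓ+1, …`,
`|μ(S ∩ T)/μ(S) - μ(T)| ≤ ϕ(ℓ)`. -/
def PhiMixing (μ : Measure (X A)) (ϕ : ℕ → ℝ) : Prop :=
  (∀ ℓ, 0 < ϕ ℓ) ∧ Antitone ϕ ∧ Tendsto ϕ atTop (nhds 0) ∧
  ∀ n ℓ : ℕ, 1 ≤ n → 1 ≤ ℓ →
    ∀ S T : Set (X A),
      MeasurableSet[MeasurableSpace.comap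
        (fun x : X A => fun i : Fin n => x i.val) inferInstance] S →
      MeasurableSet[MeasurableSpace.comap
        (fun x : X A => fun j : ℕ => x (n + ℓ - 1 + j)) inferInstance] T →
      μ S ≠ 0 →
      |(μ (S ∩ T)).toReal / (μ S).toReal - (μ T).toReal| ≤ ϕ ℓ

section Auxiliary

set_option linter.unusedSectionVars false

variable {A}

/-- The word formed by the first `n` symbols of `x`. -/
def pref (n : ℕ) (x : X A) : Fin n → A := fun i => x i

lemma cyl_eq_preimage {n : ℕ} (w : Fin n → A) : cyl A w = pref n ⁻¹' {w} := by
  ext x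
  simp [cyl, pref, funext_iff]

lemma continuous_pref (n : ℕ) : Continuous (pref (A := A) n) := by
  unfold pref
  fun_prop

lemma continuous_comp_pref {n : ℕ} (F : (Fin n → A) → ℝ) :
    Continuous fun x : X A => F (pref n x) :=
  (continuous_of_discreteTopology (f := F)).comp (continuous_pref n)

lemma continuous_shift : Continuous (shift A) := by
  unfold shift
  fun_prop

lemma continuous_prepend (a : A) : Continuous (prepend A a) := by
  refine continuous_pi fun n => ?_
  cases n with
  | zero => exact continuous_const
  | succ n => exact continuous_apply n

lemma integrable_of_continuous (η : Measure (X A)) [IsFiniteMeasure η] {f : X A → ℝ}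
    (hf : Continuous f) : Integrable f η :=
  hf.integrable_of_hasCompactSupport (HasCompactSupport.of_compactSpace f)

lemma pref_surjective [Nonempty A] (n : ℕ) : Function.Surjective (pref (A := A) n) := by
  intro w
  refine ⟨fun i => if h : i < n then w ⟨i, h⟩ else Classical.arbitrary A, ?_⟩
  ext i
  simp [pref]

/-- Expectation of a function of a random variable with finitely many values. -/
lemma integral_comp_eq_sum {Ω β : Type*} [MeasurableSpace Ω] [Fintype β] [MeasurableSpace β]
    [MeasurableSingletonClass β] (P : Measure Ω) [IsFiniteMeasure P] {Y : Ω → β}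
    (hY : Measurable Y) (F : β → ℝ) :
    ∫ y, F (Y y) ∂P = ∑ b, (P (Y ⁻¹' {b})).toReal * F b := by
  have h := integral_map (μ := P) hY.aemeasurable
    (f := F) (measurable_of_finite F).aestronglyMeasurable
  rw [← h, integral_fintype .of_finite]
  refine Finset.sum_congr rfl fun b _ => ?_
  rw [measureReal_def, Measure.map_apply hY (measurableSet_singleton b), smul_eq_mul]

lemma sum_preimage_toReal {Ω β : Type*} [MeasurableSpace Ω] [Fintype β] [MeasurableSpace β]
    [MeasurableSingletonClass β] (P : Measure Ω) [IsProbabilityMeasure P] {Y : Ω → β}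
    (hY : Measurable Y) : ∑ b, (P (Y ⁻¹' {b})).toReal = 1 := by
  simpa using (integral_comp_eq_sum P hY fun _ => 1).symm

lemma integral_comp_pref (η : Measure (X A)) [IsFiniteMeasure η] {n : ℕ}
    (F : (Fin n → A) → ℝ) :
    ∫ x, F (pref n x) ∂η = ∑ w, (η (cyl A w)).toReal * F w := by
  simp_rw [cyl_eq_preimage]
  exact integral_comp_eq_sum η (continuous_pref n).measurable F

lemma sum_cyl_toReal (η : Measure (X A)) [IsProbabilityMeasure η] (n : ℕ) :
    ∑ w : Fin n → A, (η (cyl A w)).toReal = 1 := by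
  simp_rw [cyl_eq_preimage]
  exact sum_preimage_toReal η (continuous_pref n).measurable

/-- A continuous function has vanishing variation on cylinders. -/
lemma exists_variation {f : X A → ℝ} (hf : Continuous f) :
    ∃ v : ℕ → ℝ, Tendsto v atTop (𝓝 0) ∧
      ∀ n x y, (∀ i < n, x i = y i) → |f x - f y| ≤ v n := by
  obtain ⟨C, hC⟩ := isCompact_univ.exists_bound_of_continuousOn hf.continuousOn
  have hbdd : ∀ n, BddAbove {r | ∃ x y : X A, (∀ i < n, x i = y i) ∧ r = |f x - f y|} := by
    rintro n
    refine ⟨C + C, ?_⟩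
    rintro r ⟨x, y, -, rfl⟩
    exact (abs_sub _ _).trans (add_le_add (hC x trivial) (hC y trivial))
  have hle : ∀ n x y, (∀ i < n, x i = y i) → |f x - f y| ≤ Var A f n :=
    fun n x y h => le_csSup (hbdd n) ⟨x, y, h, rfl⟩
  refine ⟨Var A f, ?_, hle⟩
  rw [Metric.tendsto_atTop]
  intro ε hε
  let K : ℕ → Set (X A × X A) := fun n => {p | (∀ i < n, p.1 i = p.2 i) ∧ ε / 2 ≤ |f p.1 - f p.2|}
  have hK : ∀ n, IsClosed (K n) := by
    intro n
    have h1 : IsClosed {p : X A × X A | ∀ i < n, p.1 i = p.2 i} := by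
      simp only [Set.ofPred_forall]
      exact isClosed_iInter fun i => isClosed_iInter fun _ =>
        isClosed_eq ((continuous_apply i).comp continuous_fst) ((continuous_apply i).comp continuous_snd)
    exact h1.inter (isClosed_le continuous_const
      ((hf.comp continuous_fst).sub (hf.comp continuous_snd)).abs)
  obtain ⟨n, hn⟩ : ∃ n, ¬ (K n).Nonempty := by
    by_contra! hne
    obtain ⟨p, hp⟩ := IsCompact.nonempty_iInter_of_sequence_nonempty_isCompact_isClosed K
      (fun n p hp => ⟨fun i hi => hp.1 i (hi.trans n.lt_succ_self), hp.2⟩) hne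
      (hK 0).isCompact hK
    rw [mem_iInter] at hp
    have hpp : p.1 = p.2 := funext fun i => (hp (i + 1)).1 i i.lt_succ_self
    have := (hp 0).2
    rw [hpp, sub_self, abs_zero] at this
    linarith
  refine ⟨n, fun m hm => ?_⟩
  have hsmall : Var A f m ≤ ε / 2 := by
    refine Real.sSup_le ?_ (by positivity)
    rintro r ⟨x, y, hxy, rfl⟩
    by_contra! h
    exact hn ⟨(x, y), fun i hi => hxy i (hi.trans_le hm), h.le⟩
  have hnonneg : 0 ≤ Var A f m := by
    refine Real.sSup_nonneg ?_
    rintro r ⟨x, y, -, rfl⟩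
    exact abs_nonneg _
  rw [Real.dist_eq, sub_zero, abs_of_nonneg hnonneg]
  linarith

lemma toReal_cyl_succ {φ : X A → ℝ} {μ : Measure (X A)} (hμ : IsEqSt A φ μ) (n : ℕ) (z : X A) :
    (μ (cyl A (pref (n + 1) z))).toReal =
      ∫ x, Real.exp (φ (prepend A (z 0) x)) *
        (cyl A (pref n (shift A z))).indicator (fun _ => 1) x ∂μ := by
  classical
  have := hμ.1
  let F : (Fin (n + 1) → A) → ℝ := fun w => if w = pref (n + 1) z then 1 else 0
  have hF : Continuous fun x => F (pref (n + 1) x) :=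
    continuous_comp_pref F
  have h := hμ.2 _ hF
  rw [integral_comp_pref] at h
  simp only [F, mul_ite, mul_one, mul_zero, Finset.sum_ite_eq', Finset.mem_univ, if_true] at h
  rw [← h]
  refine integral_congr_ae (ae_of_all _ fun x => ?_)
  have key : ∀ a, pref (n + 1) (prepend A a x) = pref (n + 1) z ↔
      a = z 0 ∧ x ∈ cyl A (pref n (shift A z)) := by
    intro a
    simp only [funext_iff, Fin.forall_fin_succ, pref, prepend, cyl, shift, Set.mem_ofPred_eq]
    rfl
  simp only [key]
  rw [Finset.sum_eq_single (z 0)]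
  · by_cases hx : x ∈ cyl A (pref n (shift A z)) <;> simp [hx]
  · intro a _ ha
    simp [ha]
  · simp

/-- The Gibbs property with subexponential error. -/
lemma abs_log_cyl_sub_birkhoffSum_le {φ : X A → ℝ} (hφ : Continuous φ) {μ : Measure (X A)}
    (hμ : IsEqSt A φ μ) {v : ℕ → ℝ}
    (hv : ∀ n x y, (∀ i < n, x i = y i) → |φ x - φ y| ≤ v n) (n : ℕ) :
    ∀ z, 0 < (μ (cyl A (pref n z))).toReal ∧
      |Real.log (μ (cyl A (pref n z))).toReal - birkhoffSum (shift A) φ n z| ≤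
        ∑ i ∈ Finset.range n, v (i + 1) := by
  have := hμ.1
  induction n with
  | zero =>
    intro z
    have : cyl A (pref 0 z) = univ := by
      ext x
      simp [cyl]
    simp [this]
  | succ n ih =>
    intro z
    obtain ⟨hpos, hlog⟩ := ih (shift A z)
    set C := cyl A (pref n (shift A z)) with hC
    have hCm : MeasurableSet C := by
      rw [hC, cyl_eq_preimage]
      exact (continuous_pref n).measurable (measurableSet_singleton _)
    have hind : ∀ c : ℝ, ∫ x, c * C.indicator (fun _ => (1 : ℝ)) x ∂μ = c * (μ C).toReal := by
      intro c
      rw [integral_const_mul, integral_indicator hCm]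
      simp [measureReal_def]
    have hi1 : Integrable (C.indicator (fun _ => (1 : ℝ))) μ :=
      (integrable_const 1).indicator hCm
    have hi2 : Integrable (fun x => Real.exp (φ (prepend A (z 0) x)) *
        C.indicator (fun _ => (1 : ℝ)) x) μ := by
      have : Integrable (fun x => Real.exp (φ (prepend A (z 0) x))) μ :=
        integrable_of_continuous μ (Real.continuous_exp.comp (hφ.comp (continuous_prepend _)))
      refine (this.indicator hCm).congr (ae_of_all _ fun x => ?_)
      by_cases hx : x ∈ C <;> simp [hx]
    have hclose : ∀ x ∈ C, |φ (prepend A (z 0) x) - φ z| ≤ v (n + 1) := by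
      intro x hx
      refine hv _ _ _ fun i hi => ?_
      cases i with
      | zero => rfl
      | succ i => exact hx ⟨i, by omega⟩
    have hlow : Real.exp (φ z - v (n + 1)) * (μ C).toReal ≤
        (μ (cyl A (pref (n + 1) z))).toReal := by
      rw [toReal_cyl_succ hμ, ← hC, ← hind]
      refine integral_mono (hi1.const_mul _) hi2 fun x => ?_
      by_cases hx : x ∈ C
      · have := abs_le.1 (hclose x hx)
        simp only [hx, indicator_of_mem, mul_one, Real.exp_le_exp]
        linarith
      · simp [hx]
    have hup : (μ (cyl A (pref (n + 1) z))).toReal ≤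
        Real.exp (φ z + v (n + 1)) * (μ C).toReal := by
      rw [toReal_cyl_succ hμ, ← hC, ← hind]
      refine integral_mono hi2 (hi1.const_mul _) fun x => ?_
      by_cases hx : x ∈ C
      · have := abs_le.1 (hclose x hx)
        simp only [hx, indicator_of_mem, mul_one, Real.exp_le_exp]
        linarith
      · simp [hx]
    have hpos' : 0 < (μ (cyl A (pref (n + 1) z))).toReal := lt_of_lt_of_le (by positivity) hlow
    refine ⟨hpos', ?_⟩
    have h1 := Real.log_le_log (by positivity) hlow
    have h2 := Real.log_le_log hpos' hup
    rw [Real.log_mul (Real.exp_ne_zero _) hpos.ne', Real.log_exp] at h1 h2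
    rw [birkhoffSum_succ', Finset.sum_range_succ]
    rw [abs_le] at hlog ⊢
    constructor <;> linarith [hlog.1, hlog.2]

/-- The finite Gibbs variational inequality. -/
lemma sum_mul_log_sub_log_le {ι : Type*} [Fintype ι] {a c : ι → ℝ} (ha : ∀ i, 0 ≤ a i)
    (hsum : ∑ i, a i = 1) (hc : ∀ i, 0 < c i) :
    ∑ i, a i * (Real.log (c i) - Real.log (a i)) ≤ Real.log (∑ i, c i) := by
  have hne : Nonempty ι := by
    by_contra h
    rw [not_nonempty_iff] at h
    simp at hsum
  set Z := ∑ i, c i with hZ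
  have hZpos : 0 < Z := Finset.sum_pos (fun i _ => hc i) Finset.univ_nonempty
  have hterm : ∀ i, a i * (Real.log (c i) - Real.log (a i)) ≤ a i * Real.log Z + (c i / Z - a i) := by
    intro i
    rcases (ha i).eq_or_lt with h | h
    · rw [← h]
      simpa using (div_pos (hc i) hZpos).le
    · have hl := Real.log_le_sub_one_of_pos (div_pos (hc i) (mul_pos hZpos h))
      rw [Real.log_div (hc i).ne' (by positivity), Real.log_mul hZpos.ne' h.ne'] at hl
      have := mul_le_mul_of_nonneg_left hl h.le
      have he : a i * (c i / (Z * a i) - 1) = c i / Z - a i := by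
        field_simp
      rw [he] at this
      linarith
  refine (Finset.sum_le_sum fun i _ => hterm i).trans_eq ?_
  rw [Finset.sum_add_distrib, ← Finset.sum_mul, hsum, Finset.sum_sub_distrib, ← Finset.sum_div,
    hsum, ← hZ, div_self hZpos.ne']
  ring

lemma natCast_mul_entSeq (η : Measure (X A)) {n : ℕ} (hn : 1 ≤ n) :
    n * entSeq A η n = ∑ w : Fin n → A, Real.negMulLog (η (cyl A w)).toReal := by
  have : (n : ℝ) ≠ 0 := by positivity
  simp only [entSeq, Real.negMulLog, neg_mul, Finset.sum_neg_distrib]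
  field_simp

lemma integral_comp_iterate_shift {η : Measure (X A)} (hη : InvProb A η) {f : X A → ℝ}
    (hf : Continuous f) (k : ℕ) : ∫ x, f ((shift A)^[k] x) ∂η = ∫ x, f x ∂η := by
  have hmp : MeasurePreserving (shift A) η η := ⟨continuous_shift.measurable, hη.2⟩
  have h := (hmp.iterate k)
  conv_rhs => rw [← h.map_eq]
  rw [integral_map h.measurable.aemeasurable hf.aestronglyMeasurable]

lemma integral_birkhoffSum {η : Measure (X A)} (hη : InvProb A η) {f : X A → ℝ}
    (hf : Continuous f) (n : ℕ) : ∫ x, birkhoffSum (shift A) f n x ∂η = n * ∫ x, f x ∂η := by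
  have := hη.1
  simp only [birkhoffSum]
  rw [integral_finsetSum]
  · simp [integral_comp_iterate_shift hη hf]
  · exact fun i _ => integrable_of_continuous η (hf.comp (continuous_shift.iterate i))

lemma continuous_birkhoffSum {f : X A → ℝ} (hf : Continuous f) (n : ℕ) :
    Continuous (birkhoffSum (shift A) f n) := by
  unfold birkhoffSum
  exact continuous_finsetSum _ fun i _ => hf.comp (continuous_shift.iterate i)

/-- If `ℓ` dominates the Birkhoff sums of `ψ` on `n`-cylinders up to `E`, then the logarithm of the
partition function of `ℓ` bounds the free energy of every invariant measure. -/
lemma entSeq_add_integral_le {η : Measure (X A)} (hη : InvProb A η) {ψ : X A → ℝ}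
    (hψ : Continuous ψ) {n : ℕ} (hn : 1 ≤ n) {ℓ : (Fin n → A) → ℝ} {E : ℝ}
    (hℓ : ∀ x, birkhoffSum (shift A) ψ n x ≤ ℓ (pref n x) + E) :
    n * (entSeq A η n + ∫ x, ψ x ∂η) ≤ Real.log (∑ w, Real.exp (ℓ w)) + E := by
  have := hη.1
  have h1 : n * ∫ x, ψ x ∂η ≤ ∑ w, (η (cyl A w)).toReal * ℓ w + E := by
    have hℓi : Integrable (fun x => ℓ (pref n x)) η :=
      integrable_of_continuous η (continuous_comp_pref ℓ)
    rw [← integral_birkhoffSum hη hψ, ← integral_comp_pref]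
    calc _ ≤ ∫ x, (ℓ (pref n x) + E) ∂η :=
          integral_mono (integrable_of_continuous η (continuous_birkhoffSum hψ n))
            (hℓi.add (integrable_const E)) hℓ
      _ = _ := by rw [integral_add hℓi (integrable_const E)]; simp
  have h2 := sum_mul_log_sub_log_le (a := fun w : Fin n → A => (η (cyl A w)).toReal)
    (c := fun w => Real.exp (ℓ w)) (fun _ => ENNReal.toReal_nonneg) (sum_cyl_toReal η n)
    (fun w => Real.exp_pos _)
  have h3 : ∑ w : Fin n → A, (η (cyl A w)).toReal *
      (Real.log (Real.exp (ℓ w)) - Real.log (η (cyl A w)).toReal) =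
      ∑ w, (η (cyl A w)).toReal * ℓ w + n * entSeq A η n := by
    rw [natCast_mul_entSeq η hn, ← Finset.sum_add_distrib]
    refine Finset.sum_congr rfl fun w _ => ?_
    rw [Real.log_exp, Real.negMulLog]
    ring
  linarith

lemma entSeq_nonneg (η : Measure (X A)) [IsProbabilityMeasure η] (n : ℕ) : 0 ≤ entSeq A η n := by
  rcases n.eq_zero_or_pos with rfl | hn
  · simp [entSeq]
  · refine nonneg_of_mul_nonneg_right ?_ (Nat.cast_pos (α := ℝ).2 hn)
    rw [natCast_mul_entSeq η hn]
    exact Finset.sum_nonneg fun w _ =>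
      Real.negMulLog_nonneg ENNReal.toReal_nonneg
        (by simpa using ENNReal.toReal_mono ENNReal.one_ne_top (prob_le_one (μ := η) (s := cyl A w)))

lemma entSeq_le_log_card [Nonempty A] {η : Measure (X A)} (hη : InvProb A η) (n : ℕ) :
    entSeq A η n ≤ Real.log (Fintype.card A) := by
  rcases n.eq_zero_or_pos with rfl | hn
  · simpa [entSeq] using Real.log_natCast_nonneg _
  · have h := entSeq_add_integral_le hη (ψ := 0) continuous_const hn (ℓ := 0) (E := 0)
      (by simp [birkhoffSum])
    have hn' : (0 : ℝ) < n := Nat.cast_pos.2 hn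
    simp at h
    exact le_of_mul_le_mul_left h hn'

lemma isBoundedUnder_ge_entSeq (η : Measure (X A)) [IsProbabilityMeasure η] :
    IsBoundedUnder (· ≥ ·) atTop (entSeq A η) :=
  isBoundedUnder_of ⟨0, entSeq_nonneg η⟩

lemma isCoboundedUnder_ge_entSeq [Nonempty A] {η : Measure (X A)} (hη : InvProb A η) :
    IsCoboundedUnder (· ≥ ·) atTop (entSeq A η) :=
  (isBoundedUnder_of ⟨_, entSeq_le_log_card hη⟩ :
    IsBoundedUnder (· ≤ ·) atTop (entSeq A η)).isCoboundedUnder_ge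

lemma iterate_shift_apply (k : ℕ) (x : X A) (n : ℕ) : (shift A)^[k] x n = x (n + k) := by
  induction k generalizing x with
  | zero => rfl
  | succ k ih =>
    rw [Function.iterate_succ_apply, ih]
    simp [shift, add_assoc]

/-- Concatenation of a sequence of words of length `N`. -/
def unblock (N : ℕ) [NeZero N] (y : ℕ → Fin N → A) : X A := fun n => y (n / N) (Fin.ofNat N n)

lemma unblock_apply (N : ℕ) [NeZero N] (y : ℕ → Fin N → A) (j : ℕ) (l : Fin N) :
    unblock N y (j * N + l) = y j l := by
  have hN : 0 < N := Nat.pos_of_ne_zero (NeZero.ne N)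
  have h1 : (j * N + (l : ℕ)) / N = j := by
    rw [mul_comm, Nat.mul_add_div hN, Nat.div_eq_of_lt l.2, add_zero]
  have h2 : Fin.ofNat N (j * N + l) = l := by
    ext
    simp [Fin.ofNat, Nat.mod_eq_of_lt l.2]
  rw [unblock, h1, h2]

lemma iterate_shift_unblock (N : ℕ) [NeZero N] (y : ℕ → Fin N → A) :
    (shift A)^[N] (unblock N y) = unblock N fun n => y (n + 1) := by
  have hN : 0 < N := Nat.pos_of_ne_zero (NeZero.ne N)
  ext n
  have h2 : Fin.ofNat N (n + N) = Fin.ofNat N n := by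
    ext
    simp [Fin.ofNat]
  rw [iterate_shift_apply, unblock, unblock, Nat.add_div_right n hN, h2]

lemma measurable_unblock (N : ℕ) [NeZero N] : Measurable (unblock (A := A) N) := by
  refine measurable_pi_lambda _ fun n => ?_
  exact (measurable_pi_apply (Fin.ofNat N n)).comp (measurable_pi_apply (n / N))

lemma map_shift_infinitePi {B : Type*} [MeasurableSpace B] (P : Measure B)
    [IsProbabilityMeasure P] :
    (Measure.infinitePi fun _ : ℕ => P).map (fun y n => y (n + 1)) =
      Measure.infinitePi fun _ : ℕ => P := by
  refine Measure.eq_infinitePi _ fun s t ht => ?_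
  have hm : Measurable fun (y : ℕ → B) n => y (n + 1) := by fun_prop
  rw [Measure.map_apply hm (MeasurableSet.pi s.countable_toSet fun i _ => ht i)]
  have : (fun (y : ℕ → B) n => y (n + 1)) ⁻¹' (s : Set ℕ).pi t =
      ((s.map (addRightEmbedding 1) : Finset ℕ) : Set ℕ).pi fun i => t (i - 1) := by
    ext y
    simp [Set.mem_pi]
  rw [this, Measure.infinitePi_pi _ fun i _ => ht _, Finset.prod_map]
  simp

/-- The shift-average over one period of the concatenation of i.i.d. words with law `P`. -/
noncomputable def blockMeasure (N : ℕ) [NeZero N] (P : Measure (Fin N → A)) : Measure (X A) :=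
  (N : ENNReal)⁻¹ • ∑ i ∈ Finset.range N,
    (Measure.infinitePi fun _ : ℕ => P).map fun y => (shift A)^[i] (unblock N y)

lemma measurable_iterate_shift_unblock (N : ℕ) [NeZero N] (i : ℕ) :
    Measurable fun y => (shift A)^[i] (unblock N y) :=
  (continuous_shift.iterate i).measurable.comp (measurable_unblock N)

lemma invProb_blockMeasure (N : ℕ) [NeZero N] (P : Measure (Fin N → A)) [IsProbabilityMeasure P] :
    InvProb A (blockMeasure N P) := by
  constructor
  · constructor
    have h : ∀ i, (Measure.infinitePi fun _ : ℕ => P).map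
        (fun y => (shift A)^[i] (unblock N y)) univ = 1 := by
      intro i
      rw [Measure.map_apply (measurable_iterate_shift_unblock N i) MeasurableSet.univ]
      simp
    simp only [blockMeasure, Measure.smul_apply, Measure.finsetSum_apply, h]
    simp [ENNReal.inv_mul_cancel, NeZero.ne N]
  · rw [blockMeasure, Measure.map_smul]
    congr 1
    have hmap : ∀ i, ((Measure.infinitePi fun _ : ℕ => P).map
        fun y => (shift A)^[i] (unblock N y)).map (shift A) =
        (Measure.infinitePi fun _ : ℕ => P).map fun y => (shift A)^[i + 1] (unblock N y) := by
      intro i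
      rw [Measure.map_map continuous_shift.measurable (measurable_iterate_shift_unblock N i)]
      congr 1
      ext1 y
      rw [Function.iterate_succ_apply', Function.comp_apply]
    have hper : (Measure.infinitePi fun _ : ℕ => P).map
        (fun y => (shift A)^[N] (unblock N y)) =
        (Measure.infinitePi fun _ : ℕ => P).map fun y => (shift A)^[0] (unblock N y) := by
      simp only [iterate_shift_unblock, Function.iterate_zero, id_eq]
      conv_rhs => rw [← map_shift_infinitePi P]
      rw [Measure.map_map (measurable_unblock N) (by fun_prop)]
      rfl
    rw [← Measure.mapₗ_apply_of_measurable continuous_shift.measurable, map_sum]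
    simp only [Measure.mapₗ_apply_of_measurable continuous_shift.measurable, hmap]
    obtain ⟨M, hM⟩ := Nat.exists_eq_succ_of_ne_zero (NeZero.ne N)
    have hr : Finset.range N = Finset.range (M + 1) := by rw [hM]
    rw [hr, Finset.sum_range_succ, Finset.sum_range_succ', ← hper,
      show (shift A)^[M + 1] = (shift A)^[N] by rw [hM]]

lemma toReal_blockMeasure (N : ℕ) [NeZero N] (P : Measure (Fin N → A)) [IsProbabilityMeasure P]
    {S : Set (X A)} (hS : MeasurableSet S) :
    (blockMeasure N P S).toReal = ∑ i ∈ Finset.range N, (N : ℝ)⁻¹ *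
      ((Measure.infinitePi fun _ : ℕ => P) ((fun y => (shift A)^[i] (unblock N y)) ⁻¹' S)).toReal := by
  simp only [blockMeasure, Measure.smul_apply, Measure.finsetSum_apply, smul_eq_mul,
    ENNReal.toReal_mul, ENNReal.toReal_inv, ENNReal.toReal_natCast]
  rw [ENNReal.toReal_sum fun i _ => ?_, Finset.mul_sum]
  · refine Finset.sum_congr rfl fun i _ => ?_
    rw [Measure.map_apply (measurable_iterate_shift_unblock N i) hS]
  · rw [Measure.map_apply (measurable_iterate_shift_unblock N i) hS]
    exact measure_ne_top _ _

lemma natCast_mul_integral_blockMeasure (N : ℕ) [NeZero N] (P : Measure (Fin N → A))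
    [IsProbabilityMeasure P] {f : X A → ℝ} (hf : Continuous f) :
    N * ∫ x, f x ∂blockMeasure N P =
      ∫ y, birkhoffSum (shift A) f N (unblock N y) ∂Measure.infinitePi fun _ : ℕ => P := by
  have hN : (N : ℝ) ≠ 0 := Nat.cast_ne_zero.2 (NeZero.ne N)
  have hprob : ∀ i, IsProbabilityMeasure ((Measure.infinitePi fun _ : ℕ => P).map
      fun y => (shift A)^[i] (unblock N y)) := fun i =>
    Measure.isProbabilityMeasure_map (measurable_iterate_shift_unblock N i).aemeasurable
  rw [blockMeasure, integral_smul_measure,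
    integral_finsetSum_measure fun i _ => integrable_of_continuous _ hf]
  simp only [birkhoffSum]
  rw [integral_finsetSum]
  · simp only [ENNReal.toReal_inv, ENNReal.toReal_natCast, smul_eq_mul]
    rw [mul_inv_cancel_left₀ hN]
    refine Finset.sum_congr rfl fun i _ => ?_
    rw [integral_map (measurable_iterate_shift_unblock N i).aemeasurable
      hf.aestronglyMeasurable]
  · intro i _
    exact (integrable_map_measure hf.aestronglyMeasurable
      (measurable_iterate_shift_unblock N i).aemeasurable).1 (integrable_of_continuous _ hf)

lemma pref_unblock (N : ℕ) [NeZero N] (y : ℕ → Fin N → A) : pref N (unblock N y) = y 0 := by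
  ext l
  simpa [pref] using unblock_apply N y 0 l

lemma integral_eval_infinitePi {β : Type*} [Fintype β] [MeasurableSpace β]
    [MeasurableSingletonClass β] (P : Measure β) [IsProbabilityMeasure P] (j : ℕ) (F : β → ℝ) :
    ∫ y, F (y j) ∂(Measure.infinitePi fun _ : ℕ => P) = ∑ b, (P {b}).toReal * F b := by
  rw [integral_comp_eq_sum _ (measurable_pi_apply j)]
  refine Finset.sum_congr rfl fun b _ => ?_
  rw [← Measure.map_apply (measurable_pi_apply j) (measurableSet_singleton b),
    Measure.infinitePi_map_eval]

/-- Lower bound for the integral of a potential against a block measure. -/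
lemma le_natCast_mul_integral_blockMeasure (N : ℕ) [NeZero N] (P : Measure (Fin N → A))
    [IsProbabilityMeasure P] {ψ : X A → ℝ} (hψ : Continuous ψ) {ℓ : (Fin N → A) → ℝ} {E : ℝ}
    (hℓ : ∀ x, ℓ (pref N x) ≤ birkhoffSum (shift A) ψ N x + E) :
    ∑ w, (P {w}).toReal * ℓ w - E ≤ N * ∫ x, ψ x ∂blockMeasure N P := by
  rw [natCast_mul_integral_blockMeasure N P hψ, ← integral_eval_infinitePi P 0 ℓ]
  have hℓi : Integrable (fun y : ℕ → Fin N → A => ℓ (y 0))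
      (Measure.infinitePi fun _ : ℕ => P) :=
    Integrable.of_bound (C := ∑ w, |ℓ w|)
      ((measurable_of_finite ℓ).comp (measurable_pi_apply 0)).aestronglyMeasurable
      (ae_of_all _ fun y => Finset.single_le_sum (f := fun w => |ℓ w|)
        (fun w _ => abs_nonneg _) (Finset.mem_univ (y 0)))
  have hψi : Integrable (fun y => birkhoffSum (shift A) ψ N (unblock N y))
      (Measure.infinitePi fun _ : ℕ => P) := by
    have := Measure.isProbabilityMeasure_map (μ := Measure.infinitePi fun _ : ℕ => P)
      (measurable_unblock (A := A) N).aemeasurable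
    exact (integrable_map_measure (continuous_birkhoffSum hψ N).aestronglyMeasurable
      (measurable_unblock N).aemeasurable).1
      (integrable_of_continuous _ (continuous_birkhoffSum hψ N))
  calc _ = ∫ y, (ℓ (y 0) - E) ∂(Measure.infinitePi fun _ : ℕ => P) := by
        rw [integral_sub hℓi (integrable_const E)]
        simp
    _ ≤ _ := integral_mono (hℓi.sub (integrable_const E)) hψi fun y => by
        have := hℓ (unblock N y)
        rw [pref_unblock] at this
        simp only
        linarith

lemma entropy_block_le_sum_negMulLog [Nonempty A] (N : ℕ) [NeZero N] (P : Measure (Fin N → A))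
    [IsProbabilityMeasure P] (hP : ∀ w, 0 < (P {w}).toReal) {i n k : ℕ} (hi : i < N)
    (hk : (k + 1) * N ≤ n) :
    k * ∑ w, Real.negMulLog (P {w}).toReal ≤
      ∑ w : Fin n → A, Real.negMulLog ((Measure.infinitePi fun _ : ℕ => P)
        ((fun y => (shift A)^[i] (unblock N y)) ⁻¹' cyl A w)).toReal := by
  set Q := Measure.infinitePi fun _ : ℕ => P with hQ
  let Y : (ℕ → Fin N → A) → Fin n → A := fun y => pref n ((shift A)^[i] (unblock N y))
  have hY : Measurable Y :=
    (continuous_pref n).measurable.comp (measurable_iterate_shift_unblock N i)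
  have hidx : ∀ j ∈ Finset.Icc 1 k, ∀ l : Fin N, i ≤ j * N + l ∧ j * N + l - i < n := by
    intro j hj l
    rw [Finset.mem_Icc] at hj
    have h1 : 1 * N ≤ j * N := Nat.mul_le_mul_right N hj.1
    have h2 : j * N ≤ k * N := Nat.mul_le_mul_right N hj.2
    have h3 := l.2
    rw [add_mul] at hk
    omega
  let blk : (Fin n → A) → ℕ → Fin N → A := fun w j l =>
    if h : j * N + l - i < n then w ⟨j * N + l - i, h⟩ else Classical.arbitrary A
  have hblk : ∀ y, ∀ j ∈ Finset.Icc 1 k, blk (Y y) j = y j := by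
    intro y j hj
    ext l
    obtain ⟨h1, h2⟩ := hidx j hj l
    simp only [blk, h2, dif_pos, Y, pref, iterate_shift_apply]
    rw [Nat.sub_add_cancel h1, unblock_apply]
  let b : (Fin n → A) → ℝ := fun w => ∏ j ∈ Finset.Icc 1 k, (P {blk w j}).toReal
  have hle : ∀ w, (Q (Y ⁻¹' {w})).toReal ≤ b w := by
    intro w
    have hsub : Y ⁻¹' {w} ⊆ ((Finset.Icc 1 k : Finset ℕ) : Set ℕ).pi fun j => {blk w j} := by
      intro y hy j hj
      rw [mem_preimage, mem_singleton_iff] at hy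
      rw [mem_singleton_iff, ← hy, hblk y j hj]
    refine (ENNReal.toReal_mono (measure_ne_top _ _) (measure_mono hsub)).trans_eq ?_
    rw [hQ, Measure.infinitePi_pi _ fun j _ => measurableSet_singleton _, ENNReal.toReal_prod]
  have hterm : ∀ w, (Q (Y ⁻¹' {w})).toReal * (-Real.log (b w)) ≤
      Real.negMulLog (Q (Y ⁻¹' {w})).toReal := by
    intro w
    rw [Real.negMulLog, neg_mul, mul_neg, neg_le_neg_iff]
    rcases (ENNReal.toReal_nonneg (a := Q (Y ⁻¹' {w}))).eq_or_lt with h | h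
    · rw [← h]
      simp
    · exact mul_le_mul_of_nonneg_left (Real.log_le_log h (hle w)) h.le
  have hsum : ∑ w, (Q (Y ⁻¹' {w})).toReal * (-Real.log (b w)) =
      k * ∑ w, Real.negMulLog (P {w}).toReal := by
    rw [← integral_comp_eq_sum Q hY fun w => -Real.log (b w)]
    have h1 : ∀ y, -Real.log (b (Y y)) =
        ∑ j ∈ Finset.Icc 1 k, -Real.log (P {y j}).toReal := by
      intro y
      rw [Real.log_prod fun j _ => (hP _).ne', Finset.sum_neg_distrib]
      congr 1
      exact Finset.sum_congr rfl fun j hj => by rw [hblk y j hj]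
    simp only [h1]
    rw [integral_finsetSum]
    · have h2 : ∀ j, ∫ y, -Real.log (P {y j}).toReal ∂Q =
          ∑ w, Real.negMulLog (P {w}).toReal := by
        intro j
        rw [hQ, integral_eval_infinitePi P j fun w => -Real.log (P {w}).toReal]
        exact Finset.sum_congr rfl fun w _ => by rw [Real.negMulLog]; ring
      simp [h2]
    · intro j _
      refine Integrable.of_bound (C := ∑ w, |-Real.log (P {w}).toReal|)
        ((measurable_of_finite fun w => -Real.log (P {w}).toReal).comp
          (measurable_pi_apply j)).aestronglyMeasurable
        (ae_of_all _ fun y => Finset.single_le_sum (f := fun w => |-Real.log (P {w}).toReal|)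
          (fun w _ => abs_nonneg _) (Finset.mem_univ (y j)))
  rw [← hsum]
  refine Finset.sum_le_sum fun w _ => (hterm w).trans_eq ?_
  rw [cyl_eq_preimage]
  rfl

lemma entropy_block_le_entSeq [Nonempty A] (N : ℕ) [NeZero N] (P : Measure (Fin N → A))
    [IsProbabilityMeasure P] (hP : ∀ w, 0 < (P {w}).toReal) {n k : ℕ} (hn : 1 ≤ n)
    (hk : (k + 1) * N ≤ n) :
    k * ∑ w, Real.negMulLog (P {w}).toReal ≤ n * entSeq A (blockMeasure N P) n := by
  have hN : (N : ℝ) ≠ 0 := Nat.cast_ne_zero.2 (NeZero.ne N)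
  rw [natCast_mul_entSeq _ hn]
  have hm : ∀ w : Fin n → A, MeasurableSet (cyl A w) := fun w => by
    rw [cyl_eq_preimage]
    exact (continuous_pref n).measurable (measurableSet_singleton w)
  simp only [toReal_blockMeasure N P (hm _)]
  have hconc : ∀ w : Fin n → A, ∑ i ∈ Finset.range N, (N : ℝ)⁻¹ *
      Real.negMulLog ((Measure.infinitePi fun _ : ℕ => P)
        ((fun y => (shift A)^[i] (unblock N y)) ⁻¹' cyl A w)).toReal ≤
      Real.negMulLog (∑ i ∈ Finset.range N, (N : ℝ)⁻¹ * ((Measure.infinitePi fun _ : ℕ => P)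
        ((fun y => (shift A)^[i] (unblock N y)) ⁻¹' cyl A w)).toReal) := fun w =>
    Real.concaveOn_negMulLog.le_map_sum (w := fun _ => (N : ℝ)⁻¹) (fun _ _ => by positivity)
      (by simp [hN]) fun _ _ => ENNReal.toReal_nonneg
  refine le_trans ?_ (Finset.sum_le_sum fun w _ => hconc w)
  rw [Finset.sum_comm]
  simp only [← Finset.mul_sum]
  rw [le_inv_mul_iff₀ (by positivity), ← nsmul_eq_mul (N : ℕ)]
  calc _ = ∑ _i ∈ Finset.range N, k * ∑ w, Real.negMulLog (P {w}).toReal := by simp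
    _ ≤ _ := Finset.sum_le_sum fun i hi =>
      entropy_block_le_sum_negMulLog N P hP (Finset.mem_range.1 hi) hk

lemma entropy_block_le [Nonempty A] (N : ℕ) [NeZero N] (P : Measure (Fin N → A))
    [IsProbabilityMeasure P] (hP : ∀ w, 0 < (P {w}).toReal) :
    ∑ w, Real.negMulLog (P {w}).toReal ≤ N * entropy A (blockMeasure N P) := by
  set H := ∑ w, Real.negMulLog (P {w}).toReal with hH
  have hN : (0 : ℝ) < N := Nat.cast_pos.2 (Nat.pos_of_ne_zero (NeZero.ne N))
  have hH0 : 0 ≤ H := Finset.sum_nonneg fun w _ =>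
    Real.negMulLog_nonneg ENNReal.toReal_nonneg
      (by simpa using ENNReal.toReal_mono ENNReal.one_ne_top (prob_le_one (μ := P) (s := {w})))
  have hinv := invProb_blockMeasure N P
  have hlim : Tendsto (fun n : ℕ => H / N - 2 * H / n) atTop (𝓝 (H / N)) := by
    simpa using tendsto_const_nhds.sub (tendsto_const_div_atTop_nhds_zero_nat (2 * H))
  have hev : ∀ᶠ n : ℕ in atTop, H / N - 2 * H / n ≤ entSeq A (blockMeasure N P) n := by
    filter_upwards [eventually_ge_atTop N] with n hn
    have hN' : 0 < N := Nat.pos_of_ne_zero (NeZero.ne N)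
    have hn0 : (0 : ℝ) < n := Nat.cast_pos.2 (hN'.trans_le hn)
    have hdiv : 1 ≤ n / N := (Nat.one_le_div_iff hN').2 hn
    have hb := entropy_block_le_entSeq N P hP (n := n) (k := n / N - 1) (hN'.trans_le hn)
      (by rw [Nat.sub_add_cancel hdiv]; exact Nat.div_mul_le_self n N)
    have hk : (n : ℝ) / N - 2 ≤ ((n / N - 1 : ℕ) : ℝ) := by
      rw [Nat.cast_sub hdiv, Nat.cast_one]
      have := (Nat.lt_floor_add_one ((n : ℝ) / N))
      rw [Nat.floor_div_eq_div] at this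
      linarith
    have h2 : ((n : ℝ) / N - 2) * H ≤ n * entSeq A (blockMeasure N P) n :=
      (mul_le_mul_of_nonneg_right hk hH0).trans hb
    have h3 : H / N - 2 * H / n = ((n : ℝ) / N - 2) * H / n := by
      field_simp
    rw [h3, div_le_iff₀ hn0, mul_comm (entSeq _ _ _)]
    exact h2
  have h := liminf_le_liminf hev hlim.isBoundedUnder_ge (isCoboundedUnder_ge_entSeq hinv)
  rw [hlim.liminf_eq] at h
  rwa [div_le_iff₀ hN, mul_comm] at h

/-- For every function `ℓ` of words of length `N` there is an invariant measure whose free energy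
is at least the logarithm of the partition function of `ℓ`, up to the error `E` with which `ℓ`
approximates Birkhoff sums. -/
lemma exists_le_entropy_add_integral [Nonempty A] (N : ℕ) [NeZero N] {ψ : X A → ℝ}
    (hψ : Continuous ψ) {ℓ : (Fin N → A) → ℝ} {E : ℝ}
    (hℓ : ∀ x, ℓ (pref N x) ≤ birkhoffSum (shift A) ψ N x + E) :
    ∃ η, InvProb A η ∧
      Real.log (∑ w, Real.exp (ℓ w)) - E ≤ N * (entropy A η + ∫ x, ψ x ∂η) := by
  set Z := ∑ w, Real.exp (ℓ w) with hZ
  have hZpos : 0 < Z := Finset.sum_pos (fun w _ => Real.exp_pos _) Finset.univ_nonempty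
  let p : PMF (Fin N → A) := PMF.ofFintype (fun w => ENNReal.ofReal (Real.exp (ℓ w) / Z)) (by
    rw [← ENNReal.ofReal_sum_of_nonneg fun w _ => by positivity, ← Finset.sum_div, ← hZ,
      div_self hZpos.ne', ENNReal.ofReal_one])
  have hp : ∀ w, (p.toMeasure {w}).toReal = Real.exp (ℓ w) / Z := by
    intro w
    rw [PMF.toMeasure_apply_singleton _ _ (measurableSet_singleton w), PMF.ofFintype_apply,
      ENNReal.toReal_ofReal (by positivity)]
  refine ⟨blockMeasure N p.toMeasure, invProb_blockMeasure N _, ?_⟩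
  have h1 := entropy_block_le N p.toMeasure fun w => by rw [hp]; positivity
  have h2 := le_natCast_mul_integral_blockMeasure N p.toMeasure hψ hℓ
  have h3 : ∑ w, Real.negMulLog (p.toMeasure {w}).toReal +
      ∑ w, (p.toMeasure {w}).toReal * ℓ w = Real.log Z := by
    have hterm : ∀ w, Real.negMulLog (p.toMeasure {w}).toReal + (p.toMeasure {w}).toReal * ℓ w =
        Real.exp (ℓ w) / Z * Real.log Z := by
      intro w
      rw [hp, Real.negMulLog, Real.log_div (Real.exp_ne_zero _) hZpos.ne', Real.log_exp]
      ring
    rw [← Finset.sum_add_distrib, Finset.sum_congr rfl fun w _ => hterm w, ← Finset.sum_mul,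
      ← Finset.sum_div, ← hZ, div_self hZpos.ne', one_mul]
  linarith

lemma bddAbove_free_energy [Nonempty A] {ψ : X A → ℝ} (hψ : Continuous ψ) :
    BddAbove {r | ∃ η : Measure (X A), InvProb A η ∧ r = entropy A η + ∫ x, ψ x ∂η} := by
  obtain ⟨C, hC⟩ := isCompact_univ.exists_bound_of_continuousOn hψ.continuousOn
  refine ⟨Real.log (Fintype.card A) + C, ?_⟩
  rintro r ⟨η, hη, rfl⟩
  have := hη.1
  refine add_le_add ?_ ?_
  · exact liminf_le_of_frequently_le (Frequently.of_forall (entSeq_le_log_card hη))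
      (isBoundedUnder_ge_entSeq η)
  · calc ∫ x, ψ x ∂η ≤ ∫ _, C ∂η := integral_mono (integrable_of_continuous η hψ)
          (integrable_const C) fun x => (le_abs_self _).trans (hC x trivial)
      _ = C := by simp

/-- The pressure is the exponential growth rate of the partition functions of any family of
functions of words approximating the Birkhoff sums up to a sublinear error. -/
lemma tendsto_log_partition [Nonempty A] {ψ : X A → ℝ} (hψ : Continuous ψ)
    {ℓ : (n : ℕ) → (Fin n → A) → ℝ} {E : ℕ → ℝ}
    (hE : Tendsto (fun n : ℕ => (n : ℝ)⁻¹ * E n) atTop (𝓝 0))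
    (hℓ : ∀ n x, |ℓ n (pref n x) - birkhoffSum (shift A) ψ n x| ≤ E n) :
    Tendsto (fun n : ℕ => (n : ℝ)⁻¹ * Real.log (∑ w, Real.exp (ℓ n w))) atTop
      (𝓝 (pressure A ψ)) := by
  have hbdd := bddAbove_free_energy hψ
  have hnonempty : {r | ∃ η : Measure (X A), InvProb A η ∧
      r = entropy A η + ∫ x, ψ x ∂η}.Nonempty := by
    obtain ⟨η, hη, -⟩ := exists_le_entropy_add_integral 1 hψ (ℓ := ℓ 1) (E := E 1)
      fun x => by linarith [(abs_le.1 (hℓ 1 x)).2]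
    exact ⟨_, η, hη, rfl⟩
  rw [Metric.tendsto_atTop']
  intro ε hε
  obtain ⟨r, ⟨η, hη, rfl⟩, hr⟩ := exists_lt_of_lt_csSup hnonempty
    (show pressure A ψ - ε / 3 < pressure A ψ by linarith)
  have := hη.1
  have hev1 : ∀ᶠ n : ℕ in atTop, entropy A η - ε / 3 < entSeq A η n :=
    eventually_lt_of_lt_liminf (show entropy A η - ε / 3 < atTop.liminf (entSeq A η) by
      rw [← entropy]; linarith) (isBoundedUnder_ge_entSeq η)
  have hev2 : ∀ᶠ n : ℕ in atTop, (n : ℝ)⁻¹ * E n < ε / 3 :=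
    hE.eventually_lt_const (by positivity)
  have hev : ∀ᶠ n : ℕ in atTop,
      dist ((n : ℝ)⁻¹ * Real.log (∑ w, Real.exp (ℓ n w))) (pressure A ψ) < ε := by
    filter_upwards [hev1, hev2, eventually_ge_atTop 1] with n h1 h2 hn
    have hn0 : (0 : ℝ) < n := Nat.cast_pos.2 hn
    have : NeZero n := ⟨by omega⟩
    have hlow := entSeq_add_integral_le hη hψ hn (ℓ := ℓ n) (E := E n)
      fun x => by linarith [(abs_le.1 (hℓ n x)).1]
    rw [← le_inv_mul_iff₀ hn0, mul_add] at hlow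
    obtain ⟨ν, hν, hup⟩ := exists_le_entropy_add_integral n hψ (ℓ := ℓ n) (E := E n)
      fun x => by linarith [(abs_le.1 (hℓ n x)).2]
    rw [← inv_mul_le_iff₀ hn0, mul_sub] at hup
    have hP : entropy A ν + ∫ x, ψ x ∂ν ≤ pressure A ψ := le_csSup hbdd ⟨ν, hν, rfl⟩
    rw [Real.dist_eq, abs_lt]
    constructor <;> linarith
  obtain ⟨n, hn⟩ := eventually_atTop.1 hev
  exact ⟨n, fun m hm => hn m hm.le⟩

end Auxiliary

/-- for an equilibrium state `μ` of `φ = log g`, the `L^q`-spectrum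
`M_μ(q) = lim_n (1/n) log Σ_{a_1^n} μ(a_1^n)^{1-q}` exists for every `q` and equals
the topological pressure `P((1-q)φ)`. -/
theorem measure_spectrum_equals_pressure
    (hcard : 1 < Fintype.card A)
    (g : X A → ℝ) (hgc : Continuous g) (hg01 : ∀ x, g x ∈ Set.Ioo (0 : ℝ) 1)
    (hgsum : ∀ x : X A, ∑ a : A, g (prepend A a x) = 1)
    (μ : Measure (X A)) (hμ : IsEqSt A (fun x => Real.log (g x)) μ) :
    ∀ q : ℝ, Tendsto (MSeq A μ q) atTop
      (nhds (pressure A (fun x => (1 - q) * Real.log (g x)))) := by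
  intro q
  have : Nonempty A := Fintype.card_pos_iff.1 (zero_lt_one.trans hcard)
  have hφ : Continuous fun x => Real.log (g x) := hgc.log fun x => (hg01 x).1.ne'
  obtain ⟨v, hv0, hv⟩ := exists_variation hφ
  have hgibbs := abs_log_cyl_sub_birkhoffSum_le hφ hμ hv
  have hpos : ∀ n (w : Fin n → A), 0 < (μ (cyl A w)).toReal := by
    intro n w
    obtain ⟨x, rfl⟩ := pref_surjective n w
    exact (hgibbs n x).1
  have hE : Tendsto (fun n : ℕ => (n : ℝ)⁻¹ *
      (|1 - q| * ∑ i ∈ Finset.range n, v (i + 1))) atTop (𝓝 0) := by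
    have h := ((tendsto_add_atTop_iff_nat 1).2 hv0).cesaro.const_mul |1 - q|
    rw [mul_zero] at h
    exact h.congr fun n => mul_left_comm _ _ _
  have hlim := tendsto_log_partition (ψ := fun x => (1 - q) * Real.log (g x))
    (ℓ := fun n w => (1 - q) * Real.log (μ (cyl A w)).toReal) (continuous_const.mul hφ) hE
    fun n x => by
      have hS : birkhoffSum (shift A) (fun x => (1 - q) * Real.log (g x)) n x =
          (1 - q) * birkhoffSum (shift A) (fun x => Real.log (g x)) n x := by
        simp only [birkhoffSum, Finset.mul_sum]
      rw [hS, ← mul_sub, abs_mul]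
      exact mul_le_mul_of_nonneg_left (hgibbs n x).2 (abs_nonneg _)
  refine hlim.congr fun n => ?_
  simp only [MSeq, one_div, Real.rpow_def_of_pos (hpos n _), mul_comm]

end RTSpec
end

section
/- Let φ : X → ℝ be a normalized potential with summable variation and μ_φ its unique equilibrium state. Then Λ(μ_φ) = lim_n (1/n) log Σ_{a_1^n ∈ A^n} (1 − ζ_{μ_φ}(a_1^n)) μ_φ(a_1^n) exists and equals γ^+(μ_φ) = lim_n (1/n) log max_{a_1^n} μ_φ(a_1^n). -/
open MeasureTheory Filter Topology Set

namespace RTSpec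

variable (A : Type*) [Fintype A] [TopologicalSpace A] [DiscreteTopology A]
  [MeasurableSpace A] [BorelSpace A]

section Auxiliary

set_option linter.unusedSectionVars false

variable {A}

/-- The cylinder of points that agree with `x` on the first `n` coordinates. -/
def block (n : ℕ) (x : X A) : Set (X A) := {y | ∀ i < n, y i = x i}

/-- The word formed by the first `n` letters of `x`, followed by `y`. -/
def splice : ℕ → X A → X A → X A
  | 0, _, y => y
  | n + 1, x, y => prepend A (x 0) (splice n (shift A x) y)

/-- The Birkhoff sum of `φ` over the first `n` iterates of `splice n x y`. -/
def birkhoff (φ : X A → ℝ) : ℕ → X A → X A → ℝ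
  | 0, _, _ => 0
  | n + 1, x, y => φ (splice (n + 1) x y) + birkhoff φ n (shift A x) y

lemma splice_apply_of_lt (n : ℕ) (x y : X A) (i : ℕ) (hi : i < n) : splice n x y i = x i := by
  induction n generalizing x i with
  | zero => omega
  | succ n ih =>
    cases i with
    | zero => rfl
    | succ i => exact ih (shift A x) i (by omega)

lemma splice_apply_add (n : ℕ) (x y : X A) (i : ℕ) : splice n x y (n + i) = y i := by
  induction n generalizing x with
  | zero => simp [splice]
  | succ n ih =>
    rw [show n + 1 + i = (n + i) + 1 by omega]
    exact ih (shift A x)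

lemma shift_iterate_apply (k : ℕ) (x : X A) (i : ℕ) : (shift A)^[k] x i = x (k + i) := by
  induction k generalizing x with
  | zero => simp
  | succ k ih =>
    rw [Function.iterate_succ_apply, ih, shift]
    congr 1
    omega

lemma continuous_splice (n : ℕ) (x : X A) : Continuous (splice n x) := by
  induction n generalizing x with
  | zero => exact continuous_id
  | succ n ih => exact (continuous_prepend _).comp (ih _)

lemma continuous_birkhoff {φ : X A → ℝ} (hφ : Continuous φ) (n : ℕ) (x : X A) :
    Continuous (birkhoff φ n x) := by
  induction n generalizing x with
  | zero => exact continuous_const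
  | succ n ih => exact (hφ.comp (continuous_splice _ _)).add (ih _)

lemma isClopen_block (n : ℕ) (x : X A) : IsClopen (block n x) := by
  have : block n x = ⋂ i ∈ Finset.range n, (fun y : X A => y i) ⁻¹' {x i} := by
    ext y
    simp [block]
  rw [this]
  exact isClopen_biInter_finset fun i _ => (isClopen_discrete _).preimage (continuous_apply i)

lemma measurableSet_block (n : ℕ) (x : X A) : MeasurableSet (block n x) :=
  (isClopen_block n x).isOpen.measurableSet

lemma continuous_indicator_block {h : X A → ℝ} (hh : Continuous h) (n : ℕ) (x : X A) :
    Continuous ((block n x).indicator h) :=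
  hh.indicator (by simp [(isClopen_block n x).frontier_eq])

lemma integrable_of_continuous_s13 (μ : Measure (X A)) [IsProbabilityMeasure μ] {h : X A → ℝ}
    (hh : Continuous h) : Integrable h μ :=
  hh.integrable_of_hasCompactSupport (HasCompactSupport.of_compactSpace h)

/-- Iterating the transfer operator: integrating over a cylinder of length `n` amounts to
integrating the Gibbs weight `exp (birkhoff φ n x)`. -/
lemma integral_indicator_block {φ : X A → ℝ} (hφ : Continuous φ) {μ : Measure (X A)}
    (hμ : IsEqSt A φ μ) (n : ℕ) (x : X A) {h : X A → ℝ} (hh : Continuous h) :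
    ∫ y, (block n x).indicator h y ∂μ =
      ∫ y, Real.exp (birkhoff φ n x y) * h (splice n x y) ∂μ := by
  induction n generalizing x h with
  | zero => simp [block, birkhoff, splice]
  | succ n ih =>
    rw [← hμ.2 _ (continuous_indicator_block hh (n + 1) x)]
    have key : ∀ y, ∑ a : A, Real.exp (φ (prepend A a y)) *
        (block (n + 1) x).indicator h (prepend A a y) =
        (block n (shift A x)).indicator
          (fun y => Real.exp (φ (prepend A (x 0) y)) * h (prepend A (x 0) y)) y := by
      intro y
      rw [Finset.sum_eq_single (x 0)]
      · have : prepend A (x 0) y ∈ block (n + 1) x ↔ y ∈ block n (shift A x) := by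
          constructor
          · intro H i hi
            exact H (i + 1) (by omega)
          · intro H i hi
            cases i with
            | zero => rfl
            | succ i => exact H i (by omega)
        by_cases hy : y ∈ block n (shift A x)
        · simp [Set.indicator, this, hy]
        · simp [Set.indicator, this, hy]
      · intro a _ ha
        have : prepend A a y ∉ block (n + 1) x := fun H => ha (H 0 (by omega))
        simp [this]
      · simp
    simp_rw [key]
    rw [ih (shift A x) (h := fun y => Real.exp (φ (prepend A (x 0) y)) *
      h (prepend A (x 0) y)) ((Real.continuous_exp.comp (hφ.comp (continuous_prepend _))).mul
      (hh.comp (continuous_prepend _)))]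
    congr 1
    ext y
    rw [birkhoff, splice, Real.exp_add]
    ring

lemma exists_abs_le {φ : X A → ℝ} (hφ : Continuous φ) : ∃ B, ∀ x, |φ x| ≤ B := by
  obtain ⟨B, hB⟩ := isCompact_univ.exists_bound_of_continuousOn hφ.continuousOn
  exact ⟨B, fun x => hB x (Set.mem_univ x)⟩

lemma var_nonneg (φ : X A → ℝ) (n : ℕ) : 0 ≤ Var A φ n := by
  refine Real.sSup_nonneg ?_
  rintro r ⟨x, y, -, rfl⟩
  exact abs_nonneg _

lemma abs_sub_le_var {φ : X A → ℝ} (hφ : Continuous φ) {n : ℕ} {x y : X A}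
    (h : ∀ i < n, x i = y i) : |φ x - φ y| ≤ Var A φ n := by
  obtain ⟨B, hB⟩ := exists_abs_le hφ
  refine le_csSup ⟨B + B, ?_⟩ ⟨x, y, h, rfl⟩
  rintro r ⟨x, y, -, rfl⟩
  exact (abs_sub _ _).trans (add_le_add (hB x) (hB y))

lemma birkhoff_sub_le {φ : X A → ℝ} (hφ : Continuous φ)
    (hvar : Summable (fun n => Var A φ (n + 1))) (n : ℕ) (x y z : X A) :
    birkhoff φ n x y - birkhoff φ n x z ≤ ∑' k, Var A φ (k + 1) := by
  refine le_trans ?_ (hvar.sum_le_tsum (Finset.range n) fun i _ => var_nonneg φ (i + 1))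
  induction n generalizing x with
  | zero => simp [birkhoff]
  | succ n ih =>
    rw [Finset.sum_range_succ, birkhoff, birkhoff]
    have h : |φ (splice (n + 1) x y) - φ (splice (n + 1) x z)| ≤ Var A φ (n + 1) :=
      abs_sub_le_var hφ fun i hi => by
        rw [splice_apply_of_lt _ _ _ _ hi, splice_apply_of_lt _ _ _ _ hi]
    have := ih (shift A x)
    have := le_abs_self (φ (splice (n + 1) x y) - φ (splice (n + 1) x z))
    linarith

lemma neg_mul_le_birkhoff {φ : X A → ℝ} {B : ℝ} (hB : ∀ x, |φ x| ≤ B) (n : ℕ) (x y : X A) :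
    -(n * B) ≤ birkhoff φ n x y := by
  induction n generalizing x with
  | zero => simp [birkhoff]
  | succ n ih =>
    rw [birkhoff]
    push_cast
    have := ih (shift A x)
    have := (abs_le.1 (hB (splice (n + 1) x y))).1
    linarith

lemma measureReal_block {φ : X A → ℝ} (hφ : Continuous φ) {μ : Measure (X A)}
    (hμ : IsEqSt A φ μ) (n : ℕ) (x : X A) :
    μ.real (block n x) = ∫ y, Real.exp (birkhoff φ n x y) ∂μ := by
  have := integral_indicator_block hφ hμ n x (h := fun _ => 1) continuous_const
  rw [integral_indicator_const _ (measurableSet_block n x)] at this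
  simpa using this

lemma block_add (n m : ℕ) (x : X A) :
    block (n + m) x = {y | y ∈ block n x ∧ (shift A)^[n] y ∈ block m ((shift A)^[n] x)} := by
  ext y
  simp only [block, Set.mem_ofPred_eq, shift_iterate_apply]
  constructor
  · exact fun H => ⟨fun i hi => H i (by omega), fun i hi => H _ (by omega)⟩
  · rintro ⟨H, H'⟩ i hi
    rcases lt_or_ge i n with h | h
    · exact H i h
    · have := H' (i - n) (by omega)
      rwa [Nat.add_sub_cancel' h] at this

lemma measureReal_block_add {φ : X A → ℝ} (hφ : Continuous φ) {μ : Measure (X A)}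
    (hμ : IsEqSt A φ μ) (n m : ℕ) (x : X A) :
    μ.real (block (n + m) x) = ∫ y, Real.exp (birkhoff φ n x y) *
      (block m ((shift A)^[n] x)).indicator (fun _ => 1) y ∂μ := by
  have hsplice : ∀ y, splice n x y ∈ block (n + m) x ↔ y ∈ block m ((shift A)^[n] x) := by
    intro y
    have h1 : splice n x y ∈ block n x := fun i hi => splice_apply_of_lt _ _ _ _ hi
    have h2 : (shift A)^[n] (splice n x y) = y := by
      ext i
      rw [shift_iterate_apply, splice_apply_add]
    rw [block_add, Set.mem_ofPred_eq, h2]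
    exact and_iff_right h1
  have := integral_indicator_block hφ hμ n x
    (h := (block (n + m) x).indicator fun _ => 1) (continuous_indicator_block continuous_const _ _)
  rw [Set.indicator_indicator, Set.inter_eq_self_of_subset_right,
    integral_indicator_const _ (measurableSet_block _ x)] at this
  · have hind : ∀ y, (block (n + m) x).indicator (fun _ => (1 : ℝ)) (splice n x y) =
        (block m ((shift A)^[n] x)).indicator (fun _ => 1) y := fun y => by
      by_cases hy : y ∈ block m ((shift A)^[n] x)
      · rw [Set.indicator_of_mem hy, Set.indicator_of_mem ((hsplice y).2 hy)]
      · rw [Set.indicator_of_notMem hy, Set.indicator_of_notMem (mt (hsplice y).1 hy)]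
    simp only [hind, smul_eq_mul, mul_one] at this
    exact this
  · exact fun y hy i hi => hy i (by omega)

lemma exp_birkhoff_le {φ : X A → ℝ} (hφ : Continuous φ)
    (hvar : Summable (fun n => Var A φ (n + 1))) {μ : Measure (X A)}
    (hμ : IsEqSt A φ μ) (n : ℕ) (x y : X A) :
    Real.exp (birkhoff φ n x y) ≤
      Real.exp (∑' k, Var A φ (k + 1)) * μ.real (block n x) := by
  have := hμ.1
  rw [measureReal_block hφ hμ, ← integral_const_mul]
  calc Real.exp (birkhoff φ n x y) = ∫ _, Real.exp (birkhoff φ n x y) ∂μ := by simp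
    _ ≤ _ := by
      refine integral_mono (integrable_const _) ((integrable_of_continuous_s13 μ
        (Real.continuous_exp.comp (continuous_birkhoff hφ n x))).const_mul _) fun z => ?_
      simp only [← Real.exp_add]
      exact Real.exp_le_exp.2 (by linarith [birkhoff_sub_le hφ hvar n x y z])

lemma measureReal_block_le_exp_birkhoff {φ : X A → ℝ} (hφ : Continuous φ)
    (hvar : Summable (fun n => Var A φ (n + 1))) {μ : Measure (X A)}
    (hμ : IsEqSt A φ μ) (n : ℕ) (x y : X A) :
    Real.exp (-∑' k, Var A φ (k + 1)) * μ.real (block n x) ≤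
      Real.exp (birkhoff φ n x y) := by
  have := hμ.1
  rw [measureReal_block hφ hμ, ← integral_const_mul]
  calc _ ≤ ∫ _, Real.exp (birkhoff φ n x y) ∂μ := by
        refine integral_mono ((integrable_of_continuous_s13 μ
          (Real.continuous_exp.comp (continuous_birkhoff hφ n x))).const_mul _)
          (integrable_const _) fun z => ?_
        simp only [← Real.exp_add]
        exact Real.exp_le_exp.2 (by linarith [birkhoff_sub_le hφ hvar n x z y])
    _ = _ := by simp

lemma integral_indicator_one_block {μ : Measure (X A)} (m : ℕ) (x : X A) :
    ∫ y, (block m x).indicator (fun _ => (1 : ℝ)) y ∂μ = μ.real (block m x) := by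
  rw [integral_indicator_const _ (measurableSet_block m x)]
  simp

/-- Upper quasi-Bernoulli inequality. -/
lemma measureReal_block_add_le {φ : X A → ℝ} (hφ : Continuous φ)
    (hvar : Summable (fun n => Var A φ (n + 1))) {μ : Measure (X A)}
    (hμ : IsEqSt A φ μ) (n m : ℕ) (x : X A) :
    μ.real (block (n + m) x) ≤ Real.exp (∑' k, Var A φ (k + 1)) *
      μ.real (block n x) * μ.real (block m ((shift A)^[n] x)) := by
  have := hμ.1
  have hc := continuous_indicator_block (h := fun _ => (1 : ℝ)) continuous_const m
    ((shift A)^[n] x)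
  rw [measureReal_block_add hφ hμ, ← integral_indicator_one_block m, ← integral_const_mul]
  refine integral_mono (integrable_of_continuous_s13 μ
    ((Real.continuous_exp.comp (continuous_birkhoff hφ n x)).mul hc))
    ((integrable_of_continuous_s13 μ hc).const_mul _) fun y => ?_
  exact mul_le_mul_of_nonneg_right (exp_birkhoff_le hφ hvar hμ n x y)
    (Set.indicator_nonneg (fun _ _ => zero_le_one) y)

/-- Lower quasi-Bernoulli inequality. -/
lemma le_measureReal_block_add {φ : X A → ℝ} (hφ : Continuous φ)
    (hvar : Summable (fun n => Var A φ (n + 1))) {μ : Measure (X A)}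
    (hμ : IsEqSt A φ μ) (n m : ℕ) (x : X A) :
    Real.exp (-∑' k, Var A φ (k + 1)) * μ.real (block n x) *
      μ.real (block m ((shift A)^[n] x)) ≤ μ.real (block (n + m) x) := by
  have := hμ.1
  have hc := continuous_indicator_block (h := fun _ => (1 : ℝ)) continuous_const m
    ((shift A)^[n] x)
  rw [measureReal_block_add hφ hμ, ← integral_indicator_one_block m, ← integral_const_mul]
  refine integral_mono ((integrable_of_continuous_s13 μ hc).const_mul _) (integrable_of_continuous_s13 μ
    ((Real.continuous_exp.comp (continuous_birkhoff hφ n x)).mul hc)) fun y => ?_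
  exact mul_le_mul_of_nonneg_right (measureReal_block_le_exp_birkhoff hφ hvar hμ n x y)
    (Set.indicator_nonneg (fun _ _ => zero_le_one) y)

lemma exp_neg_mul_le_measureReal_block {φ : X A → ℝ} (hφ : Continuous φ) {μ : Measure (X A)}
    (hμ : IsEqSt A φ μ) {B : ℝ} (hB : ∀ x, |φ x| ≤ B) (n : ℕ) (x : X A) :
    Real.exp (-(n * B)) ≤ μ.real (block n x) := by
  have := hμ.1
  rw [measureReal_block hφ hμ]
  calc Real.exp (-(n * B)) = ∫ _, Real.exp (-(n * B)) ∂μ := by simp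
    _ ≤ _ := integral_mono (integrable_const _) (integrable_of_continuous_s13 μ
        (Real.continuous_exp.comp (continuous_birkhoff hφ n x))) fun y =>
          Real.exp_le_exp.2 (neg_mul_le_birkhoff hB n x y)

lemma measureReal_block_iterate_ge {φ : X A → ℝ} (hφ : Continuous φ)
    (hvar : Summable (fun n => Var A φ (n + 1))) {μ : Measure (X A)}
    (hμ : IsEqSt A φ μ) {m : ℕ} {x : X A} (hx : (shift A)^[m] x = x) (q : ℕ) :
    (Real.exp (-∑' k, Var A φ (k + 1)) * μ.real (block m x)) ^ q ≤ μ.real (block (q * m) x) := by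
  have := hμ.1
  induction q with
  | zero => simp [block]
  | succ q ih =>
    have h := le_measureReal_block_add hφ hvar hμ m (q * m) x
    rw [hx] at h
    rw [pow_succ', Nat.succ_mul, add_comm (q * m)]
    exact (mul_le_mul_of_nonneg_left ih (by positivity)).trans h

lemma tau_le {n : ℕ} {w : Fin n → A} {k : ℕ} (hk : 1 ≤ k) {z : X A} (hz : z ∈ cyl A w)
    (hz' : ∀ i : Fin n, z (k + i.val) = w i) : tau A w ≤ k :=
  Nat.sInf_le ⟨hk, z, hz, hz'⟩

lemma tau_mem {n : ℕ} (hn : 1 ≤ n) (w : Fin n → A) :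
    (1 ≤ tau A w ∧ (cyl A w ∩ {y | ∀ i : Fin n, y (tau A w + i.val) = w i}).Nonempty) ∧
      tau A w ≤ n := by
  have hz : (fun i => w ⟨i % n, Nat.mod_lt _ hn⟩ : X A) ∈ cyl A w := fun i => by
    simp [Nat.mod_eq_of_lt i.isLt]
  have hz' : ∀ i : Fin n, (fun i => w ⟨i % n, Nat.mod_lt _ hn⟩ : X A) (n + i.val) = w i :=
    fun i => by simp [Nat.mod_eq_of_lt i.isLt]
  exact ⟨Nat.sInf_mem (s := {k | 1 ≤ k ∧
    (cyl A w ∩ {y | ∀ i : Fin n, y (k + i.val) = w i}).Nonempty}) ⟨n, hn, _, hz, hz'⟩,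
    tau_le hn hz hz'⟩

lemma hitTime'_eq_tau_iff {n : ℕ} (hn : 1 ≤ n) {w : Fin n → A} {y : X A} (hy : y ∈ cyl A w) :
    hitTime' A w y = tau A w ↔ ∀ i : Fin n, y (tau A w + i.val) = w i := by
  obtain ⟨⟨h1, -⟩, -⟩ := tau_mem hn w
  constructor
  · intro h
    have hne : {k | 1 ≤ k ∧ ∀ i : Fin n, y (k + i.val) = w i}.Nonempty := by
      by_contra hne
      rw [Set.not_nonempty_iff_eq_empty] at hne
      rw [hitTime', hne, Nat.sInf_empty] at h
      omega
    have := (Nat.sInf_mem hne).2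
    rwa [← hitTime', h] at this
  · intro h
    have hmem : tau A w ∈ {k | 1 ≤ k ∧ ∀ i : Fin n, y (k + i.val) = w i} := ⟨h1, h⟩
    have hs := Nat.sInf_mem ⟨_, hmem⟩
    exact le_antisymm (Nat.sInf_le hmem) (tau_le hs.1 hy hs.2)

/-- A word `w` and its shortest return determine a point `z` such that the set of points of
`[w]` returning at time `τ(w)` is a cylinder around `z`. -/
lemma exists_return {n : ℕ} (hn : 1 ≤ n) (w : Fin n → A) : ∃ z : X A,
    (∀ i : Fin n, z i = w i) ∧ (∀ i : Fin n, z (tau A w + i) = w i) ∧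
    cyl A w = block n ((shift A)^[tau A w] z) ∧
    cyl A w \ {y | hitTime' A w y ≠ tau A w} = block (tau A w + n) z := by
  obtain ⟨⟨-, z, hz, hz'⟩, hle⟩ := tau_mem hn w
  refine ⟨z, hz, hz', ?_, ?_⟩
  · ext y
    simp only [cyl, block, Set.mem_ofPred_eq, shift_iterate_apply]
    exact ⟨fun H i hi => (H ⟨i, hi⟩).trans (hz' ⟨i, hi⟩).symm,
      fun H i => (H i i.isLt).trans (hz' i)⟩
  · ext y
    constructor
    · rintro ⟨hy, hy'⟩ i hi
      have hy' := (hitTime'_eq_tau_iff hn hy).1 (not_not.1 hy')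
      rcases lt_or_ge i n with h | h
      · exact (hy ⟨i, h⟩).trans (hz ⟨i, h⟩).symm
      · have h1 := hy' ⟨i - tau A w, by omega⟩
        have h2 := hz' ⟨i - tau A w, by omega⟩
        simp only [Nat.add_sub_cancel' (hle.trans h)] at h1 h2
        exact h1.trans h2.symm
    · intro H
      have hy : y ∈ cyl A w := fun i => (H i (by omega)).trans (hz i)
      exact ⟨hy, not_not.2 ((hitTime'_eq_tau_iff hn hy).2 fun i =>
        (H _ (by omega)).trans (hz' i))⟩

lemma one_sub_zeta_mul {μ : Measure (X A)} [IsProbabilityMeasure μ] {n : ℕ} {w : Fin n → A}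
    (hw : μ.real (cyl A w) ≠ 0) (hmeas : MeasurableSet (cyl A w \ {y | hitTime' A w y ≠ tau A w})) :
    (1 - zeta A μ w) * (μ (cyl A w)).toReal =
      μ.real (cyl A w \ {y | hitTime' A w y ≠ tau A w}) := by
  have h := measureReal_inter_add_sdiff (μ := μ) (s := cyl A w) hmeas
  rw [Set.inter_eq_self_of_subset_right Set.sdiff_subset, Set.sdiff_sdiff_right_self] at h
  change (1 - μ.real _ / μ.real (cyl A w)) * μ.real (cyl A w) = _
  rw [sub_mul, div_mul_cancel₀ _ hw, one_mul, ← h]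
  simp

lemma sum_measureReal_block_le_one {μ : Measure (X A)} [IsProbabilityMeasure μ] {n : ℕ}
    {z : (Fin n → A) → X A} {k : ℕ} (hk : 1 ≤ k) (s : Finset (Fin n → A))
    (hz : ∀ w ∈ s, ∀ i : Fin n, z w i = w i) (hz' : ∀ w ∈ s, ∀ i : Fin n, z w (k + i) = w i) :
    ∑ w ∈ s, μ.real (block k (z w)) ≤ 1 := by
  rw [← measureReal_biUnion_finset]
  · exact measureReal_le_one
  · intro w hw w' hw' hne
    refine Set.disjoint_left.2 fun y hy hy' => hne ?_
    have key : ∀ i (hi : i < n), w ⟨i, hi⟩ = w' ⟨i, hi⟩ := by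
      intro i
      induction i using Nat.strong_induction_on with
      | _ i ih =>
        intro hi
        rw [← hz w hw ⟨i, hi⟩, ← hz w' hw' ⟨i, hi⟩]
        rcases lt_or_ge i k with h | h
        · exact (hy i h).symm.trans (hy' i h)
        · have h1 := hz' w hw ⟨i - k, by omega⟩
          have h2 := hz' w' hw' ⟨i - k, by omega⟩
          simp only [Nat.add_sub_cancel' h] at h1 h2
          exact h1.trans ((ih (i - k) (by omega) (by omega)).trans h2.symm)
    ext i
    exact key i i.isLt
  · exact fun w _ => measurableSet_block _ _

lemma cyl_eq_block {n : ℕ} (x : X A) : cyl A (fun i : Fin n => x i) = block n x := by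
  ext y
  exact ⟨fun H i hi => H ⟨i, hi⟩, fun H i => H i i.isLt⟩

/-- The largest measure of a cylinder of length `n`. -/
noncomputable def maxCyl (μ : Measure (X A)) (n : ℕ) : ℝ := ⨆ w : Fin n → A, μ.real (cyl A w)

/-- The measure of the set of points whose first `n` letters recur as early as possible. -/
noncomputable def earlyReturn (μ : Measure (X A)) (n : ℕ) : ℝ :=
  ∑ w : Fin n → A, (1 - zeta A μ w) * (μ (cyl A w)).toReal

lemma measureReal_block_le_maxCyl (μ : Measure (X A)) (n : ℕ) (x : X A) :
    μ.real (block n x) ≤ maxCyl μ n := by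
  rw [← cyl_eq_block]
  exact le_ciSup (f := fun w : Fin n → A => μ.real (cyl A w)) (Set.finite_range _).bddAbove _

lemma exists_periodic_eq_maxCyl [Nonempty A] (μ : Measure (X A)) {n : ℕ} (hn : 1 ≤ n) :
    ∃ x : X A, (shift A)^[n] x = x ∧ μ.real (block n x) = maxCyl μ n := by
  obtain ⟨w, hw⟩ := exists_eq_ciSup_of_finite (f := fun w : Fin n → A => μ.real (cyl A w))
  refine ⟨fun i => w ⟨i % n, Nat.mod_lt _ hn⟩, ?_, ?_⟩
  · ext i
    simp [shift_iterate_apply]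
  · rw [maxCyl, ← hw, ← cyl_eq_block]
    congr 2
    ext i
    simp [Nat.mod_eq_of_lt i.isLt]

lemma maxCyl_add_le [Nonempty A] {φ : X A → ℝ} (hφ : Continuous φ)
    (hvar : Summable (fun n => Var A φ (n + 1))) {μ : Measure (X A)}
    (hμ : IsEqSt A φ μ) (n m : ℕ) :
    maxCyl μ (n + m) ≤ Real.exp (∑' k, Var A φ (k + 1)) * maxCyl μ n * maxCyl μ m := by
  refine ciSup_le fun w => ?_
  obtain ⟨a⟩ := ‹Nonempty A›
  obtain ⟨x, rfl⟩ : ∃ x : X A, (fun i : Fin (n + m) => x i) = w :=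
    ⟨fun j => if h : j < n + m then w ⟨j, h⟩ else a, by ext i; simp⟩
  rw [cyl_eq_block]
  refine (measureReal_block_add_le hφ hvar hμ n m _).trans ?_
  gcongr
  · exact mul_nonneg (Real.exp_nonneg _) (Real.iSup_nonneg fun _ => measureReal_nonneg)
  · exact measureReal_block_le_maxCyl _ _ _
  · exact measureReal_block_le_maxCyl _ _ _

lemma one_sub_zeta_mul_eq_block {φ : X A → ℝ} (hφ : Continuous φ) {μ : Measure (X A)}
    (hμ : IsEqSt A φ μ) {n : ℕ} {w : Fin n → A} {y z : X A} (hy : cyl A w = block n y)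
    (hz : cyl A w \ {y | hitTime' A w y ≠ tau A w} = block (tau A w + n) z) :
    (1 - zeta A μ w) * (μ (cyl A w)).toReal = μ.real (block (tau A w + n) z) := by
  have := hμ.1
  obtain ⟨B, hB⟩ := exists_abs_le hφ
  rw [one_sub_zeta_mul, hz]
  · rw [hy]
    exact ((Real.exp_pos _).trans_le (exp_neg_mul_le_measureReal_block hφ hμ hB n y)).ne'
  · rw [hz]
    exact measurableSet_block _ _

lemma earlyReturn_le {φ : X A → ℝ} (hφ : Continuous φ)
    (hvar : Summable (fun n => Var A φ (n + 1))) {μ : Measure (X A)}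
    (hμ : IsEqSt A φ μ) {n : ℕ} (hn : 1 ≤ n) :
    earlyReturn μ n ≤ n * (Real.exp (∑' k, Var A φ (k + 1)) * maxCyl μ n) := by
  classical
  have := hμ.1
  choose z hz hz' hcyl hret using exists_return (A := A) hn
  set C := Real.exp (∑' k, Var A φ (k + 1)) * maxCyl μ n
  have hC : 0 ≤ C := mul_nonneg (Real.exp_nonneg _) (Real.iSup_nonneg fun _ => measureReal_nonneg)
  calc earlyReturn μ n ≤ ∑ w, C * μ.real (block (tau A w) (z w)) := by
        refine Finset.sum_le_sum fun w _ => ?_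
        rw [one_sub_zeta_mul_eq_block hφ hμ (hcyl w) (hret w)]
        refine (measureReal_block_add_le hφ hvar hμ _ _ _).trans ?_
        rw [mul_right_comm]
        exact mul_le_mul_of_nonneg_right (mul_le_mul_of_nonneg_left
          (measureReal_block_le_maxCyl _ _ _) (Real.exp_nonneg _)) measureReal_nonneg
    _ = ∑ k ∈ Finset.Icc 1 n, ∑ w with tau A w = k, C * μ.real (block (tau A w) (z w)) :=
        (Finset.sum_fiberwise_of_maps_to (fun (w : Fin n → A) _ => Finset.mem_Icc.2
          ⟨(tau_mem hn w).1.1, (tau_mem hn w).2⟩) _).symm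
    _ ≤ ∑ k ∈ Finset.Icc 1 n, C := by
        refine Finset.sum_le_sum fun k hk => ?_
        rw [← Finset.mul_sum]
        refine mul_le_of_le_one_right hC ?_
        refine le_trans (le_of_eq ?_) (sum_measureReal_block_le_one (μ := μ) (z := z)
          (Finset.mem_Icc.1 hk).1 (Finset.univ.filter fun w => tau A w = k)
          (fun w _ => hz w) fun w hw => ?_)
        · refine Finset.sum_congr rfl fun w hw => ?_
          rw [(Finset.mem_filter.1 hw).2]
        · rw [← (Finset.mem_filter.1 hw).2]
          exact hz' w
    _ = n * C := by simp

lemma le_earlyReturn [Nonempty A] {φ : X A → ℝ} (hφ : Continuous φ)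
    (hvar : Summable (fun n => Var A φ (n + 1))) {μ : Measure (X A)}
    (hμ : IsEqSt A φ μ) {B : ℝ} (hB : ∀ x, |φ x| ≤ B) {m n q : ℕ} (hm : 1 ≤ m) (hn : 1 ≤ n)
    (hq : n ≤ q * m) :
    Real.exp (-∑' k, Var A φ (k + 1)) * Real.exp (-(m * B)) *
      (Real.exp (-∑' k, Var A φ (k + 1)) * maxCyl μ m) ^ q ≤ earlyReturn μ n := by
  have := hμ.1
  obtain ⟨x, hx, hxm⟩ := exists_periodic_eq_maxCyl μ hm
  have hB0 : 0 ≤ B := (abs_nonneg _).trans (hB x)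
  have hterm : ∀ w : Fin n → A, 0 ≤ (1 - zeta A μ w) * (μ (cyl A w)).toReal := fun w => by
    obtain ⟨z, -, -, hcyl, hret⟩ := exists_return hn w
    rw [one_sub_zeta_mul_eq_block hφ hμ hcyl hret]
    exact measureReal_nonneg
  refine le_trans ?_ (Finset.single_le_sum (fun w _ => hterm w)
    (Finset.mem_univ fun i : Fin n => x i))
  set w : Fin n → A := fun i => x i
  obtain ⟨z, -, -, hcyl, hret⟩ := exists_return hn w
  have htau : tau A w ≤ m := tau_le hm (z := x) (fun i => rfl) fun i => by
    rw [← shift_iterate_apply m x, hx]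
  rw [one_sub_zeta_mul_eq_block hφ hμ hcyl hret]
  refine le_trans ?_ (le_measureReal_block_add hφ hvar hμ _ _ _)
  rw [← hcyl, cyl_eq_block]
  gcongr
  · have := (Real.iSup_nonneg fun _ => measureReal_nonneg : 0 ≤ maxCyl μ m)
    positivity
  · refine le_trans ?_ (exp_neg_mul_le_measureReal_block hφ hμ hB _ _)
    gcongr
  · rw [← hxm]
    refine (measureReal_block_iterate_ge hφ hvar hμ hx q).trans (measureReal_mono ?_)
    exact fun y hy i hi => hy i (hi.trans_le hq)

end Auxiliary

/-- If `M` is submultiplicative up to the factor `exp V` and `b` is comparable to `M` up to the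
indicated errors, then `M` and `b` have the same exponential growth rate. -/
lemma exists_common_growth_rate {M b : ℕ → ℝ} {V B : ℝ} (hV : 0 ≤ V)
    (hM : ∀ n : ℕ, Real.exp (-(n * B)) ≤ M n) (hM1 : ∀ n, M n ≤ 1)
    (hsub : ∀ n m, M (n + m) ≤ Real.exp V * M n * M m)
    (hup : ∀ n : ℕ, 1 ≤ n → b n ≤ n * (Real.exp V * M n))
    (hlow : ∀ m n q : ℕ, 1 ≤ m → 1 ≤ n → n ≤ q * m →
      Real.exp (-V) * Real.exp (-(m * B)) * (Real.exp (-V) * M m) ^ q ≤ b n) :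
    ∃ c : ℝ, Tendsto (fun n : ℕ => 1 / (n : ℝ) * Real.log (b n)) atTop (𝓝 c) ∧
      Tendsto (fun n : ℕ => 1 / (n : ℝ) * Real.log (M n)) atTop (𝓝 c) := by
  have hpos : ∀ n, 0 < M n := fun n => (Real.exp_pos _).trans_le (hM n)
  have hS : Subadditive fun n => Real.log (M n) + V := fun n m => by
    have := Real.log_le_log (hpos _) (hsub n m)
    rw [Real.log_mul (mul_pos (Real.exp_pos _) (hpos _)).ne' (hpos _).ne',
      Real.log_mul (Real.exp_pos _).ne' (hpos _).ne', Real.log_exp] at this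
    linarith
  have hlogM : ∀ n : ℕ, -(n * B) ≤ Real.log (M n) := fun n =>
    (Real.le_log_iff_exp_le (hpos n)).2 (hM n)
  have hbdd : BddBelow (range fun n : ℕ => (Real.log (M n) + V) / n) := by
    refine ⟨-|B|, ?_⟩
    rintro _ ⟨n, rfl⟩
    rcases Nat.eq_zero_or_pos n with rfl | hn
    · simp
    · have hn' : (0 : ℝ) < n := by exact_mod_cast hn
      simp only
      rw [le_div_iff₀ hn']
      nlinarith [hlogM n, le_abs_self B]
  set γ := hS.lim
  have hVn : ∀ c : ℝ, Tendsto (fun n : ℕ => c / (n : ℝ)) atTop (𝓝 0) := fun c =>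
    tendsto_const_div_atTop_nhds_zero_nat c
  have hγM : Tendsto (fun n : ℕ => 1 / (n : ℝ) * Real.log (M n)) atTop (𝓝 γ) := by
    have := (hS.tendsto_lim hbdd).sub (hVn V)
    rw [sub_zero] at this
    refine this.congr fun n => ?_
    ring
  have hγ0 : γ ≤ 0 := le_of_tendsto' hγM fun n =>
    mul_nonpos_of_nonneg_of_nonpos (by positivity) (Real.log_nonpos (hpos n).le (hM1 n))
  have hγ : ∀ m : ℕ, 1 ≤ m → m * γ ≤ Real.log (M m) + V := fun m hm => by
    have h := hS.lim_le_div hbdd (n := m) (by omega)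
    rw [le_div_iff₀ (by exact_mod_cast hm)] at h
    linarith
  have hlower : ∀ m n : ℕ, 1 ≤ m → 1 ≤ n → 0 < b n ∧
      γ - 2 * V / m - (3 * V + m * B - m * γ) / n ≤ 1 / (n : ℝ) * Real.log (b n) := by
    intro m n hm hn
    have hm' : (0 : ℝ) < m := by exact_mod_cast hm
    have hn' : (0 : ℝ) < n := by exact_mod_cast hn
    have h := hlow m n (n / m + 1) hm hn (by
      have := Nat.div_add_mod n m
      have := Nat.mod_lt n hm
      rw [add_mul, mul_comm (n / m)]
      omega)
    have hb : 0 < b n := lt_of_lt_of_le (by have := hpos m; positivity) h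
    refine ⟨hb, ?_⟩
    have h2 := Real.log_le_log (by have := hpos m; positivity) h
    rw [Real.log_mul (by positivity) (by have := hpos m; positivity),
      Real.log_mul (by positivity) (by positivity), Real.log_pow,
      Real.log_mul (by positivity) (hpos m).ne', Real.log_exp, Real.log_exp] at h2
    have hq : ((n / m + 1 : ℕ) : ℝ) ≤ n / m + 1 := by
      push_cast
      gcongr
      exact Nat.cast_div_le
    have h3 : (n / m + 1 : ℝ) * (m * γ - 2 * V) ≤
        ((n / m + 1 : ℕ) : ℝ) * (-V + Real.log (M m)) := by
      have hneg : m * γ - 2 * V ≤ 0 := by nlinarith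
      calc _ ≤ ((n / m + 1 : ℕ) : ℝ) * (m * γ - 2 * V) := mul_le_mul_of_nonpos_right hq hneg
        _ ≤ _ := mul_le_mul_of_nonneg_left (by linarith [hγ m hm]) (by positivity)
    have h4 : γ - 2 * V / m - (3 * V + m * B - m * γ) / n =
        1 / (n : ℝ) * (-V + -(m * B) + (n / m + 1 : ℝ) * (m * γ - 2 * V)) := by
      field_simp
      ring
    rw [h4]
    gcongr
    linarith
  refine ⟨γ, tendsto_order.2 ⟨fun a ha => ?_, fun a ha => ?_⟩, hγM⟩
  · obtain ⟨m, hm, hm1⟩ := (((tendsto_order.1 (hVn (2 * V))).2 ((γ - a) / 2)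
      (by linarith)).and (eventually_ge_atTop 1)).exists
    filter_upwards [(tendsto_order.1 (hVn (3 * V + m * B - m * γ))).2 ((γ - a) / 2)
      (by linarith), eventually_ge_atTop 1] with n hn hn1
    linarith [(hlower m n hm1 hn1).2]
  · have hlog : Tendsto (fun n : ℕ => Real.log n / (n : ℝ)) atTop (𝓝 0) :=
      (Real.isLittleO_log_id_atTop.tendsto_div_nhds_zero).comp tendsto_natCast_atTop_atTop
    have hlim := (hlog.add (hVn V)).add hγM
    rw [add_zero, zero_add] at hlim
    filter_upwards [(tendsto_order.1 hlim).2 a ha, eventually_ge_atTop 1] with n hn hn1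
    refine lt_of_le_of_lt ?_ hn
    have hn' : (0 : ℝ) < n := by exact_mod_cast hn1
    have h := Real.log_le_log (hlower 1 n le_rfl hn1).1 (hup n hn1)
    rw [Real.log_mul hn'.ne' (mul_pos (Real.exp_pos _) (hpos n)).ne',
      Real.log_mul (Real.exp_pos _).ne' (hpos n).ne', Real.log_exp] at h
    calc 1 / (n : ℝ) * Real.log (b n)
        ≤ 1 / (n : ℝ) * (Real.log n + (V + Real.log (M n))) := by gcongr
      _ = _ := by ring

/-- for the equilibrium state `μ_φ` of a normalized potential with
summable variation, `Λ(μ_φ) = lim_n (1/n) log Σ_{a_1^n} (1-ζ_{μ_φ}(a_1^n)) μ_φ(a_1^n)`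
exists and equals `γ⁺(μ_φ) = lim_n (1/n) log max_{a_1^n} μ_φ(a_1^n)`. -/
theorem lambda_equals_min_entropy
    (hcard : 1 < Fintype.card A)
    (φ : X A → ℝ) (hφc : Continuous φ)
    (hvar : Summable (fun n => Var A φ (n + 1)))
    (hnorm : Normalized A φ)
    (μφ : Measure (X A)) (hμ : IsEqSt A φ μφ) :
    ∃ c : ℝ, Tendsto (LamSeq A μφ) atTop (nhds c) ∧
      Tendsto (gammaSeq A μφ) atTop (nhds c) := by
  have : Nonempty A := Fintype.card_pos_iff.1 (by omega)
  have := hμ.1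
  obtain ⟨B, hB⟩ := exists_abs_le hφc
  refine exists_common_growth_rate (M := maxCyl μφ) (b := earlyReturn μφ) (B := B)
    (tsum_nonneg fun n => var_nonneg φ (n + 1)) (fun n => ?_)
    (fun n => ciSup_le fun w => measureReal_le_one) (maxCyl_add_le hφc hvar hμ)
    (fun n hn => earlyReturn_le hφc hvar hμ hn)
    (fun m n q hm hn hq => le_earlyReturn hφc hvar hμ hB hm hn hq)
  obtain ⟨a⟩ := ‹Nonempty A›
  exact (exp_neg_mul_le_measureReal_block hφc hμ hB n fun _ => a).trans
    (measureReal_block_le_maxCyl _ _ _)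

end RTSpec
end

section
/- For every s < −1 and every x ∈ (0,1], the upper incomplete gamma function satisfies x^s e^{−x} (1 − x/(|s|−1)) ≤ |s| Γ(s,x) ≤ x^s e^{−x} (1 − x/(1+|s|)). -/
open Set

/-- The upper incomplete Gamma function `Γ(s,x) = ∫_x^∞ t^{s-1} e^{-t} dt`. -/
noncomputable def upperGamma (s x : ℝ) : ℝ := ∫ t in Set.Ioi x, t ^ (s - 1) * Real.exp (-t)

/-- The integrand `t^p e^{-t}` is integrable away from zero, for every real exponent. -/
theorem integrableOn_rpow_mul_exp_neg_Ioi (p : ℝ) {x : ℝ} (hx : 0 < x) :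
    MeasureTheory.IntegrableOn (fun t : ℝ => t ^ p * Real.exp (-t)) (Ioi x) := by
  refine integrable_of_isBigO_exp_neg (b := 1 / 2) (by norm_num) ?_ ?_
  · refine ContinuousOn.mul (fun t ht => ?_) (by fun_prop)
    exact (Real.continuousAt_rpow_const t p
      (Or.inl (hx.trans_le (mem_Ici.mp ht)).ne')).continuousWithinAt
  · have h := (tendsto_rpow_mul_exp_neg_mul_atTop_nhds_zero p (1 / 2) (by norm_num)).isBigO_one ℝ
    have h' := h.mul
      (Asymptotics.isBigO_refl (fun t : ℝ => Real.exp (-(1 / 2) * t)) Filter.atTop)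
    refine (h'.congr (fun t => ?_) (fun t => one_mul _))
    rw [mul_assoc, ← Real.exp_add]
    ring_nf

theorem tendsto_rpow_mul_exp_neg_atTop_nhds_zero (p : ℝ) :
    Filter.Tendsto (fun t : ℝ => t ^ p * Real.exp (-t)) Filter.atTop (nhds 0) := by
  simpa using tendsto_rpow_mul_exp_neg_mul_atTop_nhds_zero p 1 one_pos

theorem hasDerivAt_rpow_mul_exp_neg (s : ℝ) {t : ℝ} (ht : 0 < t) :
    HasDerivAt (fun t : ℝ => t ^ s * Real.exp (-t))
      (t ^ (s - 1) * Real.exp (-t) * (s - t)) t := by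
  have h := (Real.hasDerivAt_rpow_const (p := s) (Or.inl ht.ne')).mul (hasDerivAt_neg t).exp
  refine h.congr_deriv ?_
  have e : t ^ s = t ^ (s - 1) * t := by
    rw [← Real.rpow_add_one ht.ne', sub_add_cancel]
  rw [e]
  ring

/-- For `s < 0` the upper incomplete Gamma function is at most `x^s e^{-x} / (x - s)`. -/
theorem upperGamma_le_div_sub {s x : ℝ} (hs : s < 0) (hx : 0 < x) :
    upperGamma s x ≤ x ^ s * Real.exp (-x) / (x - s) := by
  have hderiv : ∀ t ∈ Ici x, HasDerivAt (fun t : ℝ => -(t ^ s * Real.exp (-t) / (t - s)))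
      (t ^ (s - 1) * Real.exp (-t) * (1 + t / (t - s) ^ 2)) t := by
    intro t ht
    have ht0 : 0 < t := hx.trans_le ht
    have hts : t - s ≠ 0 := by linarith
    refine (((hasDerivAt_rpow_mul_exp_neg s ht0).div
      ((hasDerivAt_id t).sub_const s) hts).neg).congr_deriv ?_
    have e : t ^ s = t ^ (s - 1) * t := by
      rw [← Real.rpow_add_one ht0.ne', sub_add_cancel]
    simp only [id, e]
    field_simp
    ring
  have hlim : Filter.Tendsto (fun t : ℝ => -(t ^ s * Real.exp (-t) / (t - s)))
      Filter.atTop (nhds 0) := by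
    simpa [sub_eq_add_neg] using ((tendsto_rpow_mul_exp_neg_atTop_nhds_zero s).div_atTop
      (Filter.tendsto_atTop_add_const_right _ (-s) Filter.tendsto_id)).neg
  have hnonneg : ∀ t ∈ Ioi x, 0 ≤ t ^ (s - 1) * Real.exp (-t) * (1 + t / (t - s) ^ 2) := by
    intro t ht
    have ht0 : 0 < t := hx.trans ht
    positivity
  have hint := MeasureTheory.integrableOn_Ioi_deriv_of_nonneg' hderiv hnonneg hlim
  have heq := MeasureTheory.integral_Ioi_of_hasDerivAt_of_tendsto' hderiv hint hlim
  rw [zero_sub, neg_neg] at heq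
  rw [← heq]
  refine MeasureTheory.setIntegral_mono_on (integrableOn_rpow_mul_exp_neg_Ioi _ hx) hint
    measurableSet_Ioi fun t ht => ?_
  have ht0 : 0 < t := hx.trans ht
  refine le_mul_of_one_le_right (by positivity) ?_
  have : 0 ≤ t / (t - s) ^ 2 := by positivity
  linarith

/-- For `s < -1`, a lower bound for the upper incomplete Gamma function. -/
theorem le_neg_mul_upperGamma {s x : ℝ} (hs : s < -1) (hx : 0 < x) :
    x ^ s * Real.exp (-x) * (1 - x / (-s - 1)) ≤ -s * upperGamma s x := by
  have hderiv : ∀ t ∈ Ici x,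
      HasDerivAt (fun t : ℝ => -(t ^ s * Real.exp (-t) * (1 - t / (-s - 1))))
      (-s * (t ^ (s - 1) * Real.exp (-t)) -
        (t ^ (s + 1) * Real.exp (-t)) / (-s - 1)) t := by
    intro t ht
    have ht0 : 0 < t := hx.trans_le ht
    have hs1 : -s - 1 ≠ 0 := by linarith
    refine (((hasDerivAt_rpow_mul_exp_neg s ht0).mul
      (((hasDerivAt_id t).div_const (-s - 1)).const_sub 1)).neg).congr_deriv ?_
    have e : t ^ s = t ^ (s - 1) * t := by
      rw [← Real.rpow_add_one ht0.ne', sub_add_cancel]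
    simp only [id, Real.rpow_add_one ht0.ne', e]
    field_simp
    ring
  have hlim : Filter.Tendsto (fun t : ℝ => -(t ^ s * Real.exp (-t) * (1 - t / (-s - 1))))
      Filter.atTop (nhds 0) := by
    have h := (((tendsto_rpow_mul_exp_neg_atTop_nhds_zero (s + 1)).div_const (-s - 1)).sub
      (tendsto_rpow_mul_exp_neg_atTop_nhds_zero s))
    rw [zero_div, sub_zero] at h
    refine h.congr' ?_
    filter_upwards [Filter.eventually_gt_atTop 0] with t ht
    rw [Real.rpow_add_one ht.ne']
    ring
  have hint₁ := (integrableOn_rpow_mul_exp_neg_Ioi (s - 1) hx).const_mul (-s)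
  have hint := hint₁.sub ((integrableOn_rpow_mul_exp_neg_Ioi (s + 1) hx).div_const (-s - 1))
  have heq := MeasureTheory.integral_Ioi_of_hasDerivAt_of_tendsto' hderiv hint hlim
  rw [zero_sub, neg_neg] at heq
  rw [← heq, upperGamma, ← MeasureTheory.integral_const_mul]
  refine MeasureTheory.setIntegral_mono_on hint hint₁ measurableSet_Ioi fun t ht => ?_
  have ht0 : 0 < t := hx.trans ht
  have hs1 : 0 < -s - 1 := by linarith
  exact sub_le_self _ (by positivity)

/-- for every `s < -1` and every `x ∈ (0,1]`,
`x^s e^{-x} (1 - x/(|s|-1)) ≤ |s| Γ(s,x) ≤ x^s e^{-x} (1 - x/(1+|s|))`. -/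
theorem upperGamma_bounds_neg_exponent (s : ℝ) (hs : s < -1) (x : ℝ)
    (hx : x ∈ Set.Ioc (0 : ℝ) 1) :
    x ^ s * Real.exp (-x) * (1 - x / (|s| - 1)) ≤ |s| * upperGamma s x ∧
    |s| * upperGamma s x ≤ x ^ s * Real.exp (-x) * (1 - x / (1 + |s|)) := by
  obtain ⟨hx0, hx1⟩ := hx
  have hs0 : 0 < -s := by linarith
  rw [abs_of_neg (neg_pos.mp hs0)]
  refine ⟨le_neg_mul_upperGamma hs hx0, ?_⟩
  have hxs : 0 < x - s := by linarith
  calc -s * upperGamma s x ≤ -s * (x ^ s * Real.exp (-x) / (x - s)) :=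
        mul_le_mul_of_nonneg_left (upperGamma_le_div_sub (neg_pos.mp hs0) hx0) hs0.le
    _ = x ^ s * Real.exp (-x) * (1 - x / (x - s)) := by
        field_simp
        ring
    _ ≤ x ^ s * Real.exp (-x) * (1 - x / (1 + -s)) := by
        have h : x / (1 + -s) ≤ x / (x - s) :=
          div_le_div_of_nonneg_left hx0.le hxs (by linarith)
        gcongr
end

section
/- For every r ∈ (0,1) and every x > 0, the upper incomplete gamma function satisfies e^{−x} (1+x)^{r−1} ≤ Γ(r,x) ≤ e^{−x} Γ(r) (1 + x/r)^{r−1}, where Γ(r) = Γ(r,0) is the Gamma function. -/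
open Set

open MeasureTheory

/-- Shifting the variable of integration to the half-line `(0, ∞)`. -/
theorem upperGamma_eq_exp_neg_mul_integral (s x : ℝ) :
    upperGamma s x =
      Real.exp (-x) * ∫ u in Set.Ioi (0 : ℝ), Real.exp (-u) * (x + u) ^ (s - 1) := by
  have h := (measurePreserving_add_left (volume : Measure ℝ) x).setIntegral_preimage_emb
    (measurableEmbedding_addLeft x) (fun t ↦ t ^ (s - 1) * Real.exp (-t)) (Set.Ioi x)
  have hpre : (fun u ↦ x + u) ⁻¹' Set.Ioi x = Set.Ioi (0 : ℝ) := by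
    ext u
    simp
  rw [hpre] at h
  rw [upperGamma, ← h, ← integral_const_mul]
  refine integral_congr_ae (Filter.Eventually.of_forall fun u ↦ ?_)
  simp only [neg_add, Real.exp_add]
  ring

/-- The Gamma density of shape `s` has mean `s`. -/
theorem integrableOn_and_integral_exp_neg_mul_rpow_mul_affine {s : ℝ} (hs : 0 < s) (c : ℝ) :
    IntegrableOn (fun u : ℝ ↦ Real.exp (-u) * u ^ (s - 1) * (1 + c * (u - s))) (Set.Ioi 0) ∧
    ∫ u in Set.Ioi (0 : ℝ), Real.exp (-u) * u ^ (s - 1) * (1 + c * (u - s)) =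
      Real.Gamma s := by
  have h₀ := Real.GammaIntegral_convergent hs
  have h₁ := Real.GammaIntegral_convergent (add_pos hs one_pos)
  have heq : Set.EqOn
      (fun u : ℝ ↦ (1 - c * s) * (Real.exp (-u) * u ^ (s - 1)) +
        c * (Real.exp (-u) * u ^ (s + 1 - 1)))
      (fun u : ℝ ↦ Real.exp (-u) * u ^ (s - 1) * (1 + c * (u - s))) (Set.Ioi 0) := by
    intro u hu
    have hpow : u ^ (s + 1 - 1) = u ^ (s - 1) * u := by
      rw [← Real.rpow_add_one (ne_of_gt hu)]
      ring_nf
    simp only [hpow]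
    ring
  refine ⟨IntegrableOn.congr_fun ((h₀.const_mul _).add (h₁.const_mul _)) heq measurableSet_Ioi, ?_⟩
  rw [← setIntegral_congr_fun measurableSet_Ioi heq,
    integral_add (h₀.const_mul _) (h₁.const_mul _), integral_const_mul, integral_const_mul,
    ← Real.Gamma_eq_integral hs, ← Real.Gamma_eq_integral (add_pos hs one_pos),
    Real.Gamma_add_one hs.ne']
  ring

theorem integrableOn_exp_neg_mul_add_rpow {r x : ℝ} (hr₀ : 0 < r) (hr₁ : r ≤ 1) (hx : 0 ≤ x) :
    IntegrableOn (fun u : ℝ ↦ Real.exp (-u) * (x + u) ^ (r - 1)) (Set.Ioi 0) := by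
  refine (Real.GammaIntegral_convergent hr₀).mono' (Measurable.aestronglyMeasurable (by fun_prop))
    ((ae_restrict_iff' measurableSet_Ioi).2 (Filter.Eventually.of_forall fun u hu ↦ ?_))
  have hu : 0 < u := hu
  rw [Real.norm_of_nonneg (by positivity)]
  exact mul_le_mul_of_nonneg_left
    (Real.rpow_le_rpow_of_nonpos hu (by linarith) (by linarith)) (Real.exp_pos _).le

/-- Bernoulli's inequality for nonpositive exponents. -/
theorem one_add_mul_sub_one_le_rpow_of_nonpos {z p : ℝ} (hz : 0 < z) (hp : p ≤ 0) :
    1 + p * (z - 1) ≤ z ^ p := by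
  have h := Real.add_one_le_exp (Real.log z * p)
  rw [Real.rpow_def_of_pos hz]
  nlinarith [Real.log_le_sub_one_of_pos hz]

/-- The tangent line at `u = 1` of the convex function `u ↦ (x + u) ^ (r - 1)`. -/
theorem mul_affine_le_add_rpow {r x u : ℝ} (hr : r ≤ 1) (hx : 0 ≤ x) (hu : 0 < u) :
    (1 + x) ^ (r - 1) * (1 + (r - 1) / (1 + x) * (u - 1)) ≤ (x + u) ^ (r - 1) := by
  have h := one_add_mul_sub_one_le_rpow_of_nonpos (z := (x + u) / (1 + x)) (p := r - 1)
    (by positivity) (by linarith)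
  have hlin : 1 + (r - 1) / (1 + x) * (u - 1) = 1 + (r - 1) * ((x + u) / (1 + x) - 1) := by
    field_simp
    ring
  have hpow : (x + u) ^ (r - 1) = (1 + x) ^ (r - 1) * ((x + u) / (1 + x)) ^ (r - 1) := by
    rw [← Real.mul_rpow (by positivity) (by positivity), mul_div_cancel₀ _ (by positivity)]
  rw [hlin, hpow]
  exact mul_le_mul_of_nonneg_left h (by positivity)

/-- The tangent line at `u = r` of the concave function `u ↦ (1 + x / u) ^ (r - 1)`. -/
theorem add_rpow_le_mul_affine {r x u : ℝ} (hr₀ : 0 < r) (hr₁ : r ≤ 1) (hx : 0 ≤ x)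
    (hu : 0 < u) :
    (x + u) ^ (r - 1) ≤
      (1 + x / r) ^ (r - 1) *
        (u ^ (r - 1) * (1 + (1 - r) * x / (r * (x + r)) * (u - r))) := by
  set z := u * (1 + x / r) / (x + u) with hz
  have hz₀ : 0 < z := by positivity
  have hpow : (x + u) ^ (r - 1) = (1 + x / r) ^ (r - 1) * (u ^ (r - 1) * z ^ (1 - r)) := by
    have hxu : x + u = (1 + x / r) * (u * z⁻¹) := by
      rw [hz]
      field_simp
    conv_lhs => rw [hxu]
    rw [Real.mul_rpow (by positivity) (by positivity),
      Real.mul_rpow (by positivity) (by positivity), Real.inv_rpow hz₀.le,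
      ← Real.rpow_neg hz₀.le, neg_sub]
  have hbern : z ^ (1 - r) ≤ 1 + (1 - r) * (z - 1) := by
    simpa using rpow_one_add_le_one_add_mul_self (s := z - 1) (p := 1 - r)
      (by linarith) (by linarith) (by linarith)
  have hzle : z - 1 ≤ x / (r * (x + r)) * (u - r) := by
    have hdiff : x / (r * (x + r)) * (u - r) - (z - 1) =
        x * (u - r) ^ 2 / (r * (x + r) * (x + u)) := by
      rw [hz]
      field_simp
      ring
    have : 0 ≤ x * (u - r) ^ 2 / (r * (x + r) * (x + u)) := by positivity
    linarith
  have hlin : z ^ (1 - r) ≤ 1 + (1 - r) * x / (r * (x + r)) * (u - r) := by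
    rw [mul_div_assoc, mul_assoc]
    exact hbern.trans (by gcongr)
  rw [hpow]
  gcongr

/-- for every `r ∈ (0,1)` and every `x > 0`,
`e^{-x} (1+x)^{r-1} ≤ Γ(r,x) ≤ e^{-x} Γ(r) (1 + x/r)^{r-1}`. -/
theorem upperGamma_bounds_small_exponent (r : ℝ) (hr : r ∈ Set.Ioo (0 : ℝ) 1)
    (x : ℝ) (hx : 0 < x) :
    Real.exp (-x) * (1 + x) ^ (r - 1) ≤ upperGamma r x ∧
    upperGamma r x ≤ Real.exp (-x) * Real.Gamma r * (1 + x / r) ^ (r - 1) := by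
  obtain ⟨hr₀, hr₁⟩ := hr
  have hint := integrableOn_exp_neg_mul_add_rpow hr₀ hr₁.le hx.le
  rw [upperGamma_eq_exp_neg_mul_integral, mul_assoc]
  constructor
  · obtain ⟨hi, he⟩ :=
      integrableOn_and_integral_exp_neg_mul_rpow_mul_affine one_pos ((r - 1) / (1 + x))
    rw [Real.Gamma_one] at he
    refine mul_le_mul_of_nonneg_left ?_ (Real.exp_pos _).le
    have hmul := integral_const_mul (μ := volume.restrict (Set.Ioi 0)) ((1 + x) ^ (r - 1))
      fun u : ℝ ↦ Real.exp (-u) * u ^ ((1 : ℝ) - 1) * (1 + (r - 1) / (1 + x) * (u - 1))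
    rw [he, mul_one] at hmul
    rw [← hmul]
    refine setIntegral_mono_on (hi.const_mul _) hint measurableSet_Ioi fun u hu ↦ ?_
    have h := mul_le_mul_of_nonneg_left (mul_affine_le_add_rpow hr₁.le hx.le hu)
      (Real.exp_pos (-u)).le
    rw [sub_self, Real.rpow_zero]
    linarith
  · obtain ⟨hi, he⟩ := integrableOn_and_integral_exp_neg_mul_rpow_mul_affine hr₀
      ((1 - r) * x / (r * (x + r)))
    refine mul_le_mul_of_nonneg_left ?_ (Real.exp_pos _).le
    rw [mul_comm, ← he, ← integral_const_mul]
    refine setIntegral_mono_on hint (hi.const_mul _) measurableSet_Ioi fun u hu ↦ ?_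
    have h := mul_le_mul_of_nonneg_left (add_rpow_le_mul_affine hr₀ hr₁.le hx.le hu)
      (Real.exp_pos (-u)).le
    exact h.trans_eq (by ring)
end
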